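/- In the minimum-counterexample setup, for every neighbor w of x with deg_G(w)=2, letting w' denote the neighbor of w other than x, the vertex w' is not adjacent in G to any neighbor of x: for all v ∈ N_G(x), vw' is not an edge of G. -/

import Mathlib

open SimpleGraph

namespace AEC

variable {V : Type*}

/-- The set of colors appearing (under partial coloring `c`) on colored edges incident
with the vertex `u` (i.e. `F_u`). -/
def colorsAt (G : SimpleGraph V) (c : Sym2 V → Option ℕ) (u : V) : Set ℕ :=
  {γ | ∃ z, G.Adj u z ∧ c s(u, z) = some γ}

/-- `S_ab`: the set of colors appearing on the colored edges incident with `b`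
other than the edge `ab`. -/
def Sset (G : SimpleGraph V) (c : Sym2 V → Option ℕ) (a b : V) : Set ℕ :=
  {γ | ∃ z, G.Adj b z ∧ z ≠ a ∧ c s(b, z) = some γ}

/-- A partial edge coloring (colors are `ℕ`, `none` = uncolored): it may only color
edges of `G`, and colored edges sharing an endpoint receive distinct colors. -/
def ProperPartialColoring (G : SimpleGraph V) (c : Sym2 V → Option ℕ) : Prop :=
  (∀ e, (c e).isSome → e ∈ G.edgeSet) ∧
  ∀ ⦃u v w : V⦄, G.Adj u v → G.Adj u w → v ≠ w → (c s(u, v)).isSome →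
    c s(u, v) ≠ c s(u, w)

/-- A valid (acyclic) partial coloring: proper, and no cycle of `G` is bichromatic,
i.e. no cycle has all of its edges colored using only two colors. -/
def AcyclicPartialColoring (G : SimpleGraph V) (c : Sym2 V → Option ℕ) : Prop :=
  ProperPartialColoring G c ∧
  ∀ (α β : ℕ) (v : V) (W : G.Walk v v), W.IsCycle →
    ¬ ∀ e ∈ W.edges, c e = some α ∨ c e = some β

/-- An acyclic edge coloring of `G` using (at most) `k` colors: a valid partial coloring
that colors every edge of `G` with a color `< k`. -/
def IsAcyclicEdgeColoring (G : SimpleGraph V) (k : ℕ) (c : Sym2 V → Option ℕ) : Prop :=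
  AcyclicPartialColoring G c ∧ ∀ e ∈ G.edgeSet, ∃ a, a < k ∧ c e = some a

/-- `G` is 2-degenerate: every nonempty (induced) subgraph has a vertex of degree at most 2. -/
def TwoDegenerate [DecidableEq V] (G : SimpleGraph V) [DecidableRel G.Adj] : Prop :=
  ∀ s : Finset V, s.Nonempty → ∃ v ∈ s, (s.filter fun u => G.Adj v u).card ≤ 2

/-- A maximal `(α,β)`-bichromatic path from `a` to `b`: a path all of whose edges are
colored `α` or `β`, which cannot be extended at either end. -/
def IsMaximalBichromaticPath (G : SimpleGraph V) (c : Sym2 V → Option ℕ)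
    (α β : ℕ) {a b : V} (W : G.Walk a b) : Prop :=
  W.IsPath ∧ (∀ e ∈ W.edges, c e = some α ∨ c e = some β) ∧
  (∀ w, G.Adj a w → (c s(a, w) = some α ∨ c s(a, w) = some β) → w ∈ W.support) ∧
  (∀ w, G.Adj b w → (c s(b, w) = some α ∨ c s(b, w) = some β) → w ∈ W.support)

/-- An `(α,β,a,b)`-maximal bichromatic path: a maximal `(α,β)`-bichromatic path from
`a` to `b` whose edge incident on `a` is colored `α`. -/
def IsMaxBichromaticPathFrom (G : SimpleGraph V) (c : Sym2 V → Option ℕ)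
    (α β : ℕ) {a b : V} (W : G.Walk a b) : Prop :=
  IsMaximalBichromaticPath G c α β W ∧ ∃ e, W.edges.head? = some e ∧ c e = some α

/-- An `(α,β,ab)`-critical path: a maximal `(α,β)`-bichromatic path from `a` to `b` whose
edges incident on `a` and on `b` are both colored `α`. -/
def IsCriticalPath (G : SimpleGraph V) (c : Sym2 V → Option ℕ)
    (α β : ℕ) {a b : V} (W : G.Walk a b) : Prop :=
  IsMaxBichromaticPathFrom G c α β W ∧ ∃ e, W.edges.getLast? = some e ∧ c e = some α

/-- `F''_x(c)`: colors of edges from `x` to its neighbors (other than `y`) of degree ≥ 3. -/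
def Fpp [Fintype V] (G : SimpleGraph V) [DecidableRel G.Adj]
    (c : Sym2 V → Option ℕ) (x y : V) : Set ℕ :=
  {γ | ∃ z, G.Adj x z ∧ z ≠ y ∧ 3 ≤ G.degree z ∧ c s(x, z) = some γ}

/-- `F'_x(c)`: colors of edges from `x` to its neighbors (other than `y`) of degree 2. -/
def Fp [Fintype V] (G : SimpleGraph V) [DecidableRel G.Adj]
    (c : Sym2 V → Option ℕ) (x y : V) : Set ℕ :=
  {γ | ∃ z, G.Adj x z ∧ z ≠ y ∧ G.degree z = 2 ∧ c s(x, z) = some γ}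

/-- `F_x(c) = F'_x(c) ∪ F''_x(c)`. -/
def Fx [Fintype V] (G : SimpleGraph V) [DecidableRel G.Adj]
    (c : Sym2 V → Option ℕ) (x y : V) : Set ℕ :=
  Fp G c x y ∪ Fpp G c x y

section Paths

variable {V : Type*} {H H' : SimpleGraph V}

/-- There is a path from `v` to `y` avoiding `u`. -/
def ReachAvoid (H : SimpleGraph V) (u v y : V) : Prop :=
  ∃ p : H.Walk v y, p.IsPath ∧ u ∉ p.support

lemma exists_reachAvoid_of_reachable {x y : V} (h : H.Reachable x y) (hxy : x ≠ y) :
    ∃ v, H.Adj x v ∧ ReachAvoid H x v y := by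
  classical
  obtain ⟨p, hp⟩ := h.exists_isPath
  cases p with
  | nil => exact absurd rfl hxy
  | cons h q =>
    rw [Walk.cons_isPath_iff] at hp
    exact ⟨_, h, q, hp.1, hp.2⟩

lemma ReachAvoid.next {u v y : V} (h : ReachAvoid H u v y) (hvy : v ≠ y) :
    ∃ w, H.Adj v w ∧ w ≠ u ∧ ReachAvoid H v w y := by
  obtain ⟨p, hp, hu⟩ := h
  cases p with
  | nil => exact absurd rfl hvy
  | cons h q =>
    rw [Walk.cons_isPath_iff] at hp
    refine ⟨_, h, ?_, q, hp.1, hp.2⟩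
    rintro rfl
    simp at hu

lemma ReachAvoid.reachable_of_imp {u v y : V} (h : ReachAvoid H u v y)
    (hH : ∀ a b, a ≠ u → b ≠ u → H.Adj a b → H'.Adj a b) : H'.Reachable v y := by
  obtain ⟨p, -, hu⟩ := h
  refine ⟨p.transfer H' fun e he => ?_⟩
  induction e with
  | h a b =>
    have ha := p.fst_mem_support_of_mem_edges he
    have hb := p.snd_mem_support_of_mem_edges he
    exact hH a b (by rintro rfl; exact hu ha) (by rintro rfl; exact hu hb)
      (p.adj_of_mem_edges he)

lemma Walk.IsPath.exists_two_neighbors {u v : V} {p : H.Walk u v} (hp : p.IsPath) {z : V}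
    (hz : z ∈ p.support) (hzu : z ≠ u) (hzv : z ≠ v) :
    ∃ a ∈ p.support, ∃ b ∈ p.support, a ≠ b ∧ H.Adj z a ∧ H.Adj z b := by
  induction p with
  | nil => simp at hz; exact absurd hz hzu
  | @cons u u' v h q ih =>
    rw [Walk.cons_isPath_iff] at hp
    by_cases hzu' : z = u'
    · subst hzu'
      cases q with
      | nil => exact absurd rfl hzv
      | @cons _ u'' _ h' q' =>
        refine ⟨u, by simp, u'', by simp, ?_, h.symm, h'⟩
        rintro rfl
        simp at hp
    · have hz' : z ∈ q.support := by
        simpa [hzu] using hz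
      obtain ⟨a, ha, b, hb, hab⟩ := ih hp.1 hz' hzu' hzv
      exact ⟨a, by simp [ha], b, by simp [hb], hab⟩

/-- A connected graph of maximum degree two has at most two vertices of degree one. -/
lemma not_reachable_of_three_ends {x y w : V}
    (hdeg : ∀ v a b d, H.Adj v a → H.Adj v b → H.Adj v d → a = b ∨ a = d ∨ b = d)
    (hx : ∀ a b, H.Adj x a → H.Adj x b → a = b)
    (hy : ∀ a b, H.Adj y a → H.Adj y b → a = b)
    (hw : ∀ a b, H.Adj w a → H.Adj w b → a = b)
    (hxy : x ≠ y) (hxw : x ≠ w) (hyw : y ≠ w)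
    (h1 : H.Reachable x y) : ¬ H.Reachable x w := by
  classical
  obtain ⟨p, hp⟩ := h1.exists_isPath
  have closed : ∀ z ∈ p.support, ∀ t, H.Adj z t → t ∈ p.support := by
    intro z hz t hzt
    by_cases hzx : z = x
    · subst hzx
      cases p with
      | nil => exact absurd rfl hxy
      | cons h q => rw [hx _ _ hzt h]; simp
    by_cases hzy : z = y
    · subst hzy
      have h := Walk.adj_penultimate (p := p) (by
        intro hn; exact hxy hn.eq)
      rw [hy _ _ hzt h.symm]
      exact p.getVert_mem_support _
    obtain ⟨a, ha, b, hb, hab, h1, h2⟩ := Walk.IsPath.exists_two_neighbors hp hz hzx hzy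
    rcases hdeg z a b t h1 h2 hzt with h | h | h
    · exact absurd h hab
    · exact h ▸ ha
    · exact h ▸ hb
  rintro ⟨q⟩
  have key : ∀ {a b : V} (q : H.Walk a b), a ∈ p.support → b ∈ p.support := by
    intro a b q
    induction q with
    | nil => exact id
    | cons h _ ih => exact fun ha => ih (closed _ ha _ h)
  obtain ⟨a, -, b, -, hab, h1, h2⟩ :=
    Walk.IsPath.exists_two_neighbors hp (key q p.start_mem_support) hxw.symm hyw.symm
  exact hab (hw _ _ h1 h2)

end Paths

section Coloring

variable {V : Type*}

/-- The graph formed by the edges with color `α` or `β`. -/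
def bichromatic (f : V → V → Option ℕ) (α β : ℕ) : SimpleGraph V :=
  SimpleGraph.fromRel fun u v => f u v = some α ∨ f u v = some β

/-- A symmetric function is a valid partial acyclic edge coloring of `G` with colors below `K`. -/
structure Valid (G : SimpleGraph V) (K : ℕ) (f : V → V → Option ℕ) : Prop where
  symm : ∀ u v, f u v = f v u
  adj : ∀ {u v γ}, f u v = some γ → G.Adj u v
  lt : ∀ {u v γ}, f u v = some γ → γ < K
  proper : ∀ {u v w γ}, f u v = some γ → f u w = some γ → v = w
  acyclic : ∀ α β, (bichromatic f α β).IsAcyclic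

/-- The color `γ` is absent at the vertex `x`. -/
def Misses (f : V → V → Option ℕ) (x : V) (γ : ℕ) : Prop := ∀ z, f x z ≠ some γ

/-- Recolor the edge `xy`. -/
def recolor [DecidableEq V] (f : V → V → Option ℕ) (x y : V) (o : Option ℕ) : V → V → Option ℕ :=
  fun u v => if (u = x ∧ v = y) ∨ (u = y ∧ v = x) then o else f u v

variable {G : SimpleGraph V} {K : ℕ} {f g : V → V → Option ℕ} {x y : V} {α β : ℕ}

lemma Valid.bichromatic_adj (hf : Valid G K f) {u v : V} :
    (bichromatic f α β).Adj u v ↔ f u v = some α ∨ f u v = some β := by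
  have h1 := hf.symm u v
  simp only [bichromatic, SimpleGraph.fromRel_adj]
  constructor
  · rintro ⟨-, h⟩
    rw [← h1] at h
    tauto
  · intro h
    refine ⟨?_, Or.inl h⟩
    rintro rfl
    rcases h with h | h <;> exact (hf.adj h).ne rfl

lemma bichromatic_comm (f : V → V → Option ℕ) (α β : ℕ) :
    bichromatic f α β = bichromatic f β α := by
  simp only [bichromatic, or_comm]

lemma Valid.bichromatic_deg (hf : Valid G K f) (v a b d : V)
    (ha : (bichromatic f α β).Adj v a) (hb : (bichromatic f α β).Adj v b)
    (hd : (bichromatic f α β).Adj v d) : a = b ∨ a = d ∨ b = d := by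
  rw [hf.bichromatic_adj] at ha hb hd
  have := @hf.proper v
  grind

lemma Valid.bichromatic_end (hf : Valid G K f) {v : V} (hv : Misses f v α) (a b : V)
    (ha : (bichromatic f α β).Adj v a) (hb : (bichromatic f α β).Adj v b) : a = b := by
  rw [hf.bichromatic_adj] at ha hb
  exact hf.proper (ha.resolve_left (hv a)) (hb.resolve_left (hv b))

lemma Valid.mono (hf : Valid G K f) (hsymm : ∀ u v, g u v = g v u)
    (h : ∀ u v γ, g u v = some γ → f u v = some γ) : Valid G K g where
  symm := hsymm
  adj h' := hf.adj (h _ _ _ h')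
  lt h' := hf.lt (h _ _ _ h')
  proper h1 h2 := hf.proper (h _ _ _ h1) (h _ _ _ h2)
  acyclic α β := by
    refine (hf.acyclic α β).anti fun u v huv => ?_
    rw [bichromatic, SimpleGraph.fromRel_adj] at huv ⊢
    exact ⟨huv.1, huv.2.imp (Or.imp (h _ _ _) (h _ _ _)) (Or.imp (h _ _ _) (h _ _ _))⟩

lemma Valid.exists_color_of_reachable (hf : Valid G K f) (hxy : x ≠ y)
    (h : (bichromatic f α β).Reachable x y) (hx : Misses f x α) : ∃ z, f x z = some β := by
  obtain ⟨v, hv, -⟩ := exists_reachAvoid_of_reachable h hxy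
  rw [hf.bichromatic_adj] at hv
  exact ⟨v, hv.resolve_left (hx v)⟩

variable [DecidableEq V]

lemma Valid.uncolor (hf : Valid G K f) (x y : V) : Valid G K (recolor f x y none) :=
  hf.mono (by have := hf.symm; grind [recolor]) (by grind [recolor])

/-- Color an uncolored edge whose ends are not joined by a bichromatic path. -/
lemma Valid.color (hf : Valid G K f) (hxy : G.Adj x y) (hα : α < K) (hx : Misses f x α)
    (hy : Misses f y α) (hn : ∀ β, ¬ (bichromatic f α β).Reachable x y) :
    Valid G K (recolor f x y (some α)) where
  symm := by have := hf.symm; grind [recolor]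
  adj := by
    have := @hf.adj
    have := hxy.symm
    intro u v γ h
    grind [recolor]
  lt := by
    have := @hf.lt
    intro u v γ h
    grind [recolor]
  proper := by
    have := @hf.proper
    have := hxy.ne
    intro u v w γ h1 h2
    simp only [Misses] at hx hy
    grind [recolor]
  acyclic a b := by
    by_cases hab : a = α ∨ b = α
    · obtain ⟨β, h1, h2⟩ : ∃ β, bichromatic f a b = bichromatic f α β ∧
          bichromatic (recolor f x y (some α)) a b =
            bichromatic (recolor f x y (some α)) α β := by
        rcases hab with rfl | rfl
        · exact ⟨b, rfl, rfl⟩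
        · exact ⟨a, bichromatic_comm _ _ _, bichromatic_comm _ _ _⟩
      rw [h2]
      have := (hf.acyclic α β).sup_edge_of_not_reachable (hn β)
      refine this.anti fun u v huv => ?_
      rw [bichromatic, SimpleGraph.fromRel_adj] at huv
      rw [SimpleGraph.sup_adj, SimpleGraph.edge_adj, hf.bichromatic_adj]
      have := hf.symm u v
      grind [recolor]
    · refine (hf.acyclic a b).anti fun u v huv => ?_
      rw [bichromatic, SimpleGraph.fromRel_adj] at huv ⊢
      grind [recolor]

/-- Color an uncolored edge whose ends see disjoint sets of colors. -/
lemma Valid.color_of_disjoint (hf : Valid G K f) (hxy : G.Adj x y) (hα : α < K)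
    (hx : Misses f x α) (hy : Misses f y α) (hn : ∀ β, Misses f x β ∨ Misses f y β) :
    Valid G K (recolor f x y (some α)) := by
  refine hf.color hxy hα hx hy fun β h => ?_
  obtain ⟨z, hz⟩ := hf.exists_color_of_reachable hxy.ne h hx
  obtain ⟨t, ht⟩ := hf.exists_color_of_reachable hxy.ne' h.symm hy
  rcases hn β with h | h
  · exact h z hz
  · exact h t ht

lemma recolor_recolor (f : V → V → Option ℕ) (x y : V) (o o' : Option ℕ) :
    recolor (recolor f x y o) x y o' = recolor f x y o' := by
  funext u v; grind [recolor]

lemma recolor_self (hf : ∀ u v, f u v = f v u) {o : Option ℕ} (h : f x y = o) :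
    recolor f x y o = f := by
  funext u v; grind [recolor]

end Coloring

section Counting

variable {V : Type*} {G : SimpleGraph V} {K : ℕ} {f : V → V → Option ℕ} {x y y' : V}

open Classical in
/-- The colors below `K` absent at `v`. -/
noncomputable def freeColors (K : ℕ) (f : V → V → Option ℕ) (v : V) : Finset ℕ :=
  (Finset.range K).filter fun γ => Misses f v γ

lemma mem_freeColors {v : V} {γ : ℕ} : γ ∈ freeColors K f v ↔ γ < K ∧ Misses f v γ := by
  simp [freeColors]

/-- The vertices `x` and `y'` are the neighbors of `y`, which has degree two. -/
structure IsSmall (G : SimpleGraph V) (x y y' : V) : Prop where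
  adj : G.Adj x y
  adj' : G.Adj y y'
  ne : y' ≠ x
  only : ∀ z, G.Adj y z → z = x ∨ z = y'

variable [Fintype V] [DecidableRel G.Adj]

lemma three_le_degree {v a b d : V} (ha : G.Adj v a) (hb : G.Adj v b) (hd : G.Adj v d)
    (hab : a ≠ b) (had : a ≠ d) (hbd : b ≠ d) : 3 ≤ G.degree v := by
  classical
  have h : ({a, b, d} : Finset V) ⊆ G.neighborFinset v := by
    intro z hz
    rw [mem_neighborFinset]
    simp at hz
    grind
  have := Finset.card_le_card h
  rwa [Finset.card_eq_three.2 ⟨a, b, d, hab, had, hbd, rfl⟩, card_neighborFinset_eq_degree] at this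

lemma IsSmall.degree_eq (hs : IsSmall G x y y') : G.degree y = 2 := by
  classical
  rw [← card_neighborFinset_eq_degree, Finset.card_eq_two]
  refine ⟨x, y', hs.ne.symm, ?_⟩
  ext z
  rw [mem_neighborFinset]
  have := hs.adj.symm
  have := hs.adj'
  have := hs.only z
  simp
  grind

lemma exists_isSmall (hxy : G.Adj x y) (hy : G.degree y = 2) : ∃ y', IsSmall G x y y' := by
  classical
  rw [← card_neighborFinset_eq_degree, Finset.card_eq_two] at hy
  obtain ⟨a, b, hab, h⟩ := hy
  have h' : ∀ z, G.Adj y z ↔ z = a ∨ z = b := fun z => by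
    rw [← mem_neighborFinset, h]; simp
  rcases (h' x).1 hxy.symm with rfl | rfl
  · exact ⟨b, hxy, (h' b).2 (.inr rfl), hab.symm, fun z hz => (h' z).1 hz⟩
  · exact ⟨a, hxy, (h' a).2 (.inl rfl), hab, fun z hz => ((h' z).1 hz).symm⟩

lemma Valid.card_add_le (hf : Valid G K f) {v : V} {T : Finset ℕ} {U : Finset V}
    (hT : ∀ γ ∈ T, ∃ z, f v z = some γ) (hU : ∀ z ∈ U, G.Adj v z ∧ f v z = none) :
    T.card + U.card ≤ G.degree v := by
  classical
  have : Nonempty V := ⟨v⟩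
  choose! φ hφ using hT
  have hinj : Set.InjOn φ T := by
    intro a ha b hb h
    have h1 := hφ a ha
    rw [h, hφ b hb] at h1
    exact (Option.some.inj h1).symm
  have hdisj : Disjoint (T.image φ) U := by
    rw [Finset.disjoint_left]
    intro z hz hz'
    obtain ⟨γ, hγ, rfl⟩ := Finset.mem_image.1 hz
    have := (hU _ hz').2
    rw [hφ γ hγ] at this
    cases this
  rw [← Finset.card_image_of_injOn hinj, ← Finset.card_union_of_disjoint hdisj,
    ← card_neighborFinset_eq_degree]
  refine Finset.card_le_card fun z hz => ?_
  rw [mem_neighborFinset]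
  rcases Finset.mem_union.1 hz with hz | hz
  · obtain ⟨γ, hγ, rfl⟩ := Finset.mem_image.1 hz
    exact hf.adj (hφ γ hγ)
  · exact (hU z hz).1

lemma Valid.le_card_freeColors (hf : Valid G K f) {v : V} {U : Finset V}
    (hU : ∀ z ∈ U, G.Adj v z ∧ f v z = none) :
    K + U.card ≤ (freeColors K f v).card + G.degree v := by
  classical
  have h := hf.card_add_le (T := (Finset.range K).filter fun γ => ¬ Misses f v γ)
    (by simp [Misses]) hU
  have h2 := Finset.card_filter_add_card_filter_not (s := Finset.range K) (fun γ => Misses f v γ)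
  rw [Finset.card_range] at h2
  have : (freeColors K f v).card = ((Finset.range K).filter fun γ => Misses f v γ).card := by
    congr
  omega

lemma Valid.two_le_card_freeColors (hf : Valid G K f) (hK : ∀ v, G.degree v + 1 ≤ K)
    (hxy : G.Adj x y) (h : f x y = none) : 2 ≤ (freeColors K f x).card := by
  have := hf.le_card_freeColors (v := x) (U := {y}) (by simp [hxy, h])
  have := hK x
  simp at *
  omega

lemma Valid.misses_of_all (hf : Valid G K f) (hK : ∀ v, G.degree v + 1 ≤ K) {v : V} {a : ℕ}
    (h : ∀ γ < K, γ ≠ a → ∃ z, f v z = some γ) :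
    Misses f v a ∧ K ≤ G.degree v + 1 := by
  classical
  have hKv := hK v
  by_cases ha : a < K
  · constructor
    · intro z hz
      have := hf.card_add_le (v := v) (T := Finset.range K) (U := ∅) (by
        intro γ hγ
        by_cases h1 : γ = a
        · exact ⟨z, h1 ▸ hz⟩
        · exact h γ (Finset.mem_range.1 hγ) h1) (by simp)
      simp at this
      omega
    · have := hf.card_add_le (v := v) (T := (Finset.range K).erase a) (U := ∅) (by
        intro γ hγ
        simp at hγ
        exact h γ hγ.2 hγ.1) (by simp)
      rw [Finset.card_erase_of_mem (by simpa using ha)] at this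
      simp at this
      omega
  · exact ⟨fun z hz => ha (hf.lt hz), by
      have := hf.card_add_le (v := v) (T := Finset.range K) (U := ∅) (by
        intro γ hγ
        simp at hγ
        exact h γ hγ (by omega)) (by simp)
      simp at this
      omega⟩

end Counting

section Stuck

variable {V : Type*} [DecidableEq V] {G : SimpleGraph V} {K : ℕ} {f : V → V → Option ℕ}
  {x y y' : V} {α δ ε : ℕ}

lemma Valid.recolor_pendant (hf : Valid G K f) (hs : IsSmall G x y y') (hxy : f x y = none)
    (hε : ε < K) (hfree : ∀ z, z ≠ y → f y' z ≠ some ε) :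
    Valid G K (recolor f y y' (some ε)) := by
  have hsymm := hf.symm
  have hadj := @hf.adj
  have h1 := hs.only
  have hne := hs.ne
  have hne' := hs.adj.ne
  have hne2 := hs.adj'.ne
  have hy : ∀ γ, Misses (recolor f y y' none) y γ := by
    intro γ z hz
    grind [recolor]
  rw [← recolor_recolor f y y' none]
  refine (hf.uncolor y y').color_of_disjoint hs.adj' hε (hy ε) ?_ fun β => .inl (hy β)
  intro z hz
  grind [recolor]

lemma Valid.color_of_not_reachable (hf : Valid G K f) (hs : IsSmall G x y y') (hxy : f x y = none)
    (hδ : f y y' = some δ) (hα : α < K) (hαδ : α ≠ δ) (hx : Misses f x α)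
    (hn : ¬ (bichromatic f α δ).Reachable x y) : Valid G K (recolor f x y (some α)) := by
  have hsymm := hf.symm
  have hadj := @hf.adj
  have h1 := hs.only
  have hy : Misses f y α := by
    intro z hz
    grind
  refine hf.color hs.adj hα hx hy fun β h => ?_
  obtain ⟨z, hz⟩ := hf.exists_color_of_reachable hs.adj.ne' h.symm hy
  grind

variable [Fintype V] [DecidableRel G.Adj]

lemma Valid.reachable_of_stuck (hf : Valid G K f) (hs : IsSmall G x y y') (hxy : f x y = none)
    {Φ : Finset ℕ} (hΦ : 2 ≤ Φ.card) (hΦf : Φ ⊆ freeColors K f x)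
    (stuck : ∀ ε, ∀ α ∈ Φ, ¬ Valid G K (recolor (recolor f y y' (some ε)) x y (some α)))
    (hε : ε < K) (hfree : ∀ z, z ≠ y → f y' z ≠ some ε) :
    (∃ z, f x z = some ε ∧ 3 ≤ G.degree z) ∧
      ∀ α ∈ Φ, (bichromatic (recolor f y y' (some ε)) α ε).Reachable x y := by
  have hg := hf.recolor_pendant hs hxy hε hfree
  set g := recolor f y y' (some ε) with hgdef
  have hne := hs.ne
  have hne' := hs.adj.ne
  have hxg : ∀ z, g x z = f x z := by grind [recolor]
  have hgxy : g x y = none := by rw [hxg, hxy]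
  have hgy : g y y' = some ε := by grind [recolor]
  have key : ∀ α ∈ Φ, α ≠ ε → (bichromatic g α ε).Reachable x y := by
    intro α hα hne
    by_contra h
    have h2 := mem_freeColors.1 (hΦf hα)
    exact stuck ε α hα (hg.color_of_not_reachable hs hgxy hgy h2.1 hne
      (fun z => by rw [hxg]; exact h2.2 z) h)
  have hmiss : ∀ α ∈ Φ, Misses g x α := fun α hα z => by
    rw [hxg]; exact (mem_freeColors.1 (hΦf hα)).2 z
  obtain ⟨z, hz⟩ : ∃ z, g x z = some ε := by
    obtain ⟨α, hα, hαε⟩ := Finset.exists_mem_ne hΦ ε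
    exact hg.exists_color_of_reachable hne' (key α hα hαε) (hmiss α hα)
  have hall : ∀ α ∈ Φ, α ≠ ε := by
    rintro α hα rfl
    exact hmiss α hα z hz
  refine ⟨⟨z, by rw [← hxg, hz], ?_⟩, fun α hα => key α hα (hall α hα)⟩
  have step : ∀ α ∈ Φ, ∃ w, w ≠ x ∧ g z w = some α := by
    intro α hα
    obtain ⟨v, hv, hr⟩ := exists_reachAvoid_of_reachable (key α hα (hall α hα)) hne'
    rw [hg.bichromatic_adj] at hv
    have hvz : v = z := hg.proper (hv.resolve_left (hmiss α hα v)) hz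
    subst hvz
    have hvy : v ≠ y := by rintro rfl; rw [hgxy] at hz; cases hz
    obtain ⟨w, hw, hwx, -⟩ := hr.next hvy
    rw [hg.bichromatic_adj] at hw
    refine ⟨w, hwx, hw.resolve_right fun h => hwx (hg.proper h ?_)⟩
    rw [← hg.symm, hz]
  obtain ⟨a, ha, b, hb, hab⟩ := Finset.one_lt_card.1 hΦ
  obtain ⟨w1, h1, h1'⟩ := step a ha
  obtain ⟨w2, h2, h2'⟩ := step b hb
  refine three_le_degree (hg.adj hz).symm (hg.adj h1') (hg.adj h2') h1.symm h2.symm ?_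
  rintro rfl
  rw [h1'] at h2'
  exact hab (Option.some.inj h2')

/-- If an edge `xy` at a vertex `y` of degree two cannot be colored, then the colors of the two
edges from `x` to vertices of large degree are exactly those available for the other edge at `y`. -/
lemma Valid.big_of_stuck (hf : Valid G K f) (hK : ∀ v, G.degree v + 1 ≤ K)
    (hbig : ((G.neighborFinset x).filter fun z => 3 ≤ G.degree z).card ≤ 2)
    (hs : IsSmall G x y y') (hxy : f x y = none)
    {Φ : Finset ℕ} (hΦ : 2 ≤ Φ.card) (hΦf : Φ ⊆ freeColors K f x)
    (stuck : ∀ ε, ∀ α ∈ Φ, ¬ Valid G K (recolor (recolor f y y' (some ε)) x y (some α))) :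
    (∃ z₁ z₂ a b, z₁ ≠ z₂ ∧ f x z₁ = some a ∧ f x z₂ = some b ∧ 3 ≤ G.degree z₁ ∧
      3 ≤ G.degree z₂ ∧ ∀ z, G.Adj x z → 3 ≤ G.degree z → z = z₁ ∨ z = z₂) ∧
    ∀ z ε, 3 ≤ G.degree z → f x z = some ε → (∀ t, t ≠ y → f y' t ≠ some ε) ∧
      ∀ α ∈ Φ, (bichromatic (recolor f y y' (some ε)) α ε).Reachable x y := by
  have hfree : ∀ ε ∈ freeColors K (recolor f y y' none) y', ε < K ∧
      ∀ z, z ≠ y → f y' z ≠ some ε := by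
    intro ε hε
    rw [mem_freeColors] at hε
    refine ⟨hε.1, fun z hz h => hε.2 z ?_⟩
    have := hs.adj'.ne
    grind [recolor]
  have hstuck := fun ε hε => hf.reachable_of_stuck (ε := ε) hs hxy hΦ hΦf stuck
    (hfree ε hε).1 (hfree ε hε).2
  have hcard := (hf.uncolor y y').two_le_card_freeColors hK hs.adj'.symm (by grind [recolor])
  have h1 : ∀ ε ∈ freeColors K (recolor f y y' none) y', ∃ z, f x z = some ε ∧ 3 ≤ G.degree z :=
    fun ε hε => (hstuck ε hε).1
  have : Nonempty V := ⟨x⟩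
  choose! φ hφ hφ3 using h1
  have hinj : Set.InjOn φ ((freeColors K (recolor f y y' none) y' : Finset ℕ) : Set ℕ) := by
    intro a ha b hb h
    have h1 := hφ a ha
    rw [h, hφ b hb] at h1
    exact (Option.some.inj h1).symm
  have hmaps : Set.MapsTo φ ((freeColors K (recolor f y y' none) y' : Finset ℕ) : Set ℕ)
      ((G.neighborFinset x).filter fun z => 3 ≤ G.degree z : Finset V) := by
    intro a ha
    simp only [Finset.coe_filter, mem_neighborFinset, Set.mem_ofPred_eq]
    exact ⟨hf.adj (hφ a ha), hφ3 a ha⟩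
  have hsurj := Finset.surjOn_of_injOn_of_card_le φ hmaps hinj (hbig.trans hcard)
  have hsurj' : ∀ z, G.Adj x z → 3 ≤ G.degree z →
      ∃ ε ∈ freeColors K (recolor f y y' none) y', φ ε = z := by
    intro z h1 h2
    exact hsurj (by simpa using ⟨h1, h2⟩)
  constructor
  · obtain ⟨a, ha, b, hb, hab⟩ := Finset.one_lt_card.1 hcard
    have hne : φ a ≠ φ b := fun h => hab (hinj ha hb h)
    refine ⟨φ a, φ b, a, b, hne, hφ a ha, hφ b hb, hφ3 a ha, hφ3 b hb, ?_⟩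
    have : ({φ a, φ b} : Finset V) = (G.neighborFinset x).filter fun z => 3 ≤ G.degree z := by
      refine Finset.eq_of_subset_of_card_le ?_ ?_
      · intro z hz
        have := hmaps ha
        have := hmaps hb
        simp at *
        grind
      · rwa [Finset.card_pair hne]
    intro z h1 h2
    have h3 : z ∈ (G.neighborFinset x).filter fun z => 3 ≤ G.degree z := by
      simpa using ⟨h1, h2⟩
    rw [← this] at h3
    simpa using h3
  · intro z ε h1 h2
    obtain ⟨ε', hε', rfl⟩ := hsurj' z (hf.adj h2) h1
    have : ε' = ε := Option.some.inj ((hφ ε' hε').symm.trans h2)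
    subst this
    exact ⟨(hfree ε' hε').2, (hstuck ε' hε').2⟩

end Stuck

section Extend

variable {V : Type*} {G : SimpleGraph V} {K : ℕ} {f : V → V → Option ℕ}
  {x y y' i i' j j' : V}

lemma Valid.bichromatic_end_of_isSmall (hf : Valid G K f) (hs : IsSmall G x y y')
    (hxy : f x y = none) {α β : ℕ} (a b : V)
    (ha : (bichromatic f α β).Adj y a) (hb : (bichromatic f α β).Adj y b) : a = b := by
  have h : ∀ z, (bichromatic f α β).Adj y z → z = y' := by
    intro z hz
    rw [hf.bichromatic_adj] at hz
    have hadj : G.Adj y z := by rcases hz with h | h <;> exact hf.adj h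
    refine (hs.only z hadj).resolve_left ?_
    rintro rfl
    rw [hf.symm, hxy] at hz
    simp at hz
  rw [h a ha, h b hb]

variable [DecidableEq V] [Fintype V] [DecidableRel G.Adj]

/-- Of two uncolored edges from `x` to vertices of degree two, one can be colored. -/
lemma Valid.color_pair (hf : Valid G K f) (hK : ∀ v, G.degree v + 1 ≤ K)
    (hbig : ((G.neighborFinset x).filter fun z => 3 ≤ G.degree z).card ≤ 2)
    (hi : IsSmall G x i i') (hj : IsSmall G x j j') (hij : i ≠ j)
    (hxi : f x i = none) (hxj : f x j = none)
    {Φ : Finset ℕ} (hΦ : 2 ≤ Φ.card) (hΦf : Φ ⊆ freeColors K f x) :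
    ∃ g, Valid G K g ∧ (∀ u v, u ≠ i → u ≠ j → v ≠ i → v ≠ j → g u v = f u v) ∧
      (∀ u v, g u v = none → f u v = none) ∧ (g x i ≠ none ∨ g x j ≠ none) ∧
      (∀ γ, g x i = some γ → γ ∈ Φ) ∧ ∀ γ, g x j = some γ → γ ∈ Φ := by
  by_contra hno
  push Not at hno
  have hi1 := hi.ne
  have hj1 := hj.ne
  have hi2 := hi.adj.ne
  have hj2 := hj.adj.ne
  have hi3 := hi.adj'.ne
  have hj3 := hj.adj'.ne
  have hsymm := hf.symm
  obtain ⟨⟨z, -, a, -, -, hz, -, hz3, -⟩, h1⟩ := hf.big_of_stuck hK hbig hi hxi hΦ hΦf (by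
    intro ε α hα hv
    obtain ⟨γ, h, h'⟩ := hno _ hv (by grind [recolor]) (by grind [recolor])
      (by grind [recolor]) (by grind [recolor])
    grind [recolor])
  have hzi : z ≠ i := by rintro rfl; grind
  have hzj : z ≠ j := by rintro rfl; grind
  have ha := hf.lt hz
  have hv1 := hf.recolor_pendant hi hxi ha (h1 z a hz3 hz).1
  obtain ⟨-, h2⟩ := hv1.big_of_stuck (Φ := Φ) hK hbig hj (by grind [recolor]) hΦ (by
    intro α hα
    have := hΦf hα
    rw [mem_freeColors] at this ⊢
    refine ⟨this.1, fun t => ?_⟩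
    have := this.2 t
    grind [recolor]) (by
    intro ε α hα hv
    obtain ⟨γ, h, h'⟩ := hno _ hv (by grind [recolor]) (by grind [recolor])
      (by grind [recolor]) (by grind [recolor])
    grind [recolor])
  have h3 := h2 z a hz3 (by grind [recolor])
  have hv2 := hv1.recolor_pendant hj (by grind [recolor]) ha h3.1
  set c := recolor (recolor f i i' (some a)) j j' (some a) with hc
  have hci : c i i' = some a := by grind [recolor]
  have hcx : ∀ t, c x t = f x t := by grind [recolor]
  have hstuck := hv2.reachable_of_stuck (Φ := Φ) (ε := a) hi (by rw [hcx, hxi]) hΦ (by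
    intro α hα
    have := hΦf hα
    rw [mem_freeColors] at this ⊢
    exact ⟨this.1, fun t => by rw [hcx]; exact this.2 t⟩) (by
    intro ε α hα hv
    obtain ⟨γ, h, h'⟩ := hno _ hv (by grind [recolor]) (by grind [recolor])
      (by grind [recolor]) (by grind [recolor])
    grind [recolor]) ha (by
    intro t ht h
    exact ht (hv2.proper h (by rw [hv2.symm, hci])))
  rw [recolor_self hv2.symm hci] at hstuck
  obtain ⟨α, hα⟩ : Φ.Nonempty := Finset.card_pos.1 (by omega)
  refine not_reachable_of_three_ends hv2.bichromatic_deg (hv2.bichromatic_end (α := α) ?_)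
    (hv2.bichromatic_end_of_isSmall hi (by rw [hcx, hxi]))
    (hv2.bichromatic_end_of_isSmall hj (by rw [hcx, hxj])) hi2 hj2 hij
    (hstuck.2 α hα) (h3.2 α hα)
  intro t
  rw [hcx]
  exact (mem_freeColors.1 (hΦf hα)).2 t

end Extend

section Extension

variable {V : Type*} [Fintype V] {G : SimpleGraph V} [DecidableRel G.Adj] {K κ : ℕ}
  {f g h : V → V → Option ℕ} {x y y' : V}

/-- `w` is a neighbor of `x` of degree two. -/
def SmallNbr (G : SimpleGraph V) [DecidableRel G.Adj] (x w : V) : Prop :=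
  G.Adj x w ∧ G.degree w = 2

/-- `g` arises from `f` by changing edges at neighbors of `x` of degree two, without uncoloring
edges and without putting the color `κ` on new edges at `x`. -/
structure Ext (G : SimpleGraph V) [DecidableRel G.Adj] (x : V) (κ : ℕ)
    (f g : V → V → Option ℕ) : Prop where
  agree : ∀ u v, ¬ SmallNbr G x u → ¬ SmallNbr G x v → g u v = f u v
  none : ∀ u v, g u v = none → f u v = none
  new : ∀ z γ, g x z = some γ → f x z = some γ ∨ (G.degree z = 2 ∧ γ ≠ κ)

lemma Ext.trans (h1 : Ext G x κ f g) (h2 : Ext G x κ g h) : Ext G x κ f h where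
  agree u v hu hv := (h2.agree u v hu hv).trans (h1.agree u v hu hv)
  none u v huv := h1.none u v (h2.none u v huv)
  new z γ hz := (h2.new z γ hz).elim (h1.new z γ) .inr

lemma SmallNbr.exists_isSmall (hs : SmallNbr G x y) : ∃ y', IsSmall G x y y' :=
  AEC.exists_isSmall hs.1 hs.2

lemma Valid.exists_ext (hf : Valid G K f) (hK : ∀ v, G.degree v + 1 ≤ K)
    (hbig : ((G.neighborFinset x).filter fun z => 3 ≤ G.degree z).card ≤ 2) (κ : ℕ) :
    ∃ g, Valid G K g ∧ Ext G x κ f g ∧ ∀ z₁ z₂, SmallNbr G x z₁ → SmallNbr G x z₂ →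
      g x z₁ = none → g x z₂ = none → z₁ = z₂ := by
  classical
  induction hn : (Finset.univ.filter fun z => f x z = none).card using Nat.strong_induction_on
    generalizing f with
  | _ n ih =>
    by_cases hall : ∀ z₁ z₂, SmallNbr G x z₁ → SmallNbr G x z₂ →
      f x z₁ = none → f x z₂ = none → z₁ = z₂
    · exact ⟨f, hf, ⟨fun _ _ _ _ => rfl, fun _ _ h => h, fun _ _ h => .inl h⟩, hall⟩
    push Not at hall
    obtain ⟨i, j, hi, hj, hxi, hxj, hij⟩ := hall
    obtain ⟨i', hi'⟩ := hi.exists_isSmall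
    obtain ⟨j', hj'⟩ := hj.exists_isSmall
    have hc := hf.le_card_freeColors (v := x) (U := {i, j}) (by simp [hi.1, hj.1, hxi, hxj])
    rw [Finset.card_pair hij] at hc
    have hΦ : 2 ≤ ((freeColors K f x).erase κ).card := by
      have := Finset.pred_card_le_card_erase (s := freeColors K f x) (a := κ)
      have := hK x
      omega
    obtain ⟨g, hg, hagree, hnone, hor, hi2, hj2⟩ :=
      hf.color_pair hK hbig hi' hj' hij hxi hxj hΦ (Finset.erase_subset _ _)
    have hext : Ext G x κ f g := by
      refine ⟨fun u v hu hv => hagree u v ?_ ?_ ?_ ?_, hnone, fun z γ hz => ?_⟩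
      iterate 4 (rintro rfl; contradiction)
      by_cases hzi : z = i
      · subst hzi
        exact .inr ⟨hi.2, (Finset.mem_erase.1 (hi2 γ hz)).1⟩
      by_cases hzj : z = j
      · subst hzj
        exact .inr ⟨hj.2, (Finset.mem_erase.1 (hj2 γ hz)).1⟩
      rw [hagree x z hi.1.ne hj.1.ne hzi hzj] at hz
      exact .inl hz
    obtain ⟨g', h1, h2, h3⟩ := ih _ (by
      rw [← hn]
      refine Finset.card_lt_card ((Finset.ssubset_iff_of_subset fun z hz => ?_).2 ?_)
      · simp only [Finset.mem_filter_univ] at hz ⊢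
        exact hnone x z hz
      · rcases hor with h | h
        · exact ⟨i, by simpa using hxi, by simpa using h⟩
        · exact ⟨j, by simpa using hxj, by simpa using h⟩) hg rfl
    exact ⟨g', h1, hext.trans h2, h3⟩

end Extension

section Critical

variable {V : Type*} [Fintype V] {G : SimpleGraph V} [DecidableRel G.Adj]
  {K κ : ℕ} {f g : V → V → Option ℕ} {x y y' : V}

/-- There are more colors than the maximum degree, and `G` cannot be acyclically edge colored while
every graph obtained by deleting an edge can. -/
structure Critical (G : SimpleGraph V) [DecidableRel G.Adj] (K : ℕ) : Prop where
  deg : ∀ v, G.degree v + 1 ≤ K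
  stuck : ∀ f, Valid G K f → ∃ u v, G.Adj u v ∧ f u v = none
  del : ∀ u v, G.Adj u v → ∃ f, Valid G K f ∧
    ∀ a b, G.Adj a b → f a b = none → (a = u ∧ b = v) ∨ (a = v ∧ b = u)

/-- A valid coloring in which exactly the edge `xy` is uncolored. -/
structure FullExcept (G : SimpleGraph V) (K : ℕ) (f : V → V → Option ℕ) (x y : V) : Prop where
  valid : Valid G K f
  uncolored : f x y = none
  full : ∀ a b, G.Adj a b → f a b = none → (a = x ∧ b = y) ∨ (a = y ∧ b = x)

/-- At most two neighbors of `x` have degree at least three. -/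
def FewBig (G : SimpleGraph V) [DecidableRel G.Adj] (x : V) : Prop :=
  ((G.neighborFinset x).filter fun z => 3 ≤ G.degree z).card ≤ 2

lemma Critical.exists_fullExcept (hG : Critical G K) (hxy : G.Adj x y) :
    ∃ f, FullExcept G K f x y := by
  obtain ⟨f, hf, h⟩ := hG.del x y hxy
  refine ⟨f, hf, ?_, h⟩
  obtain ⟨u, v, huv, h'⟩ := hG.stuck f hf
  have := hf.symm
  rcases h u v huv h' with ⟨rfl, rfl⟩ | ⟨rfl, rfl⟩
  · exact h'
  · rw [this, h']

lemma Critical.exists_fullExcept_ext (hG : Critical G K) (hx : FewBig G x) (hf : Valid G K f)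
    (hfull : ∀ a b, G.Adj a b → f a b = none →
      (a = x ∧ SmallNbr G x b) ∨ (b = x ∧ SmallNbr G x a)) (κ : ℕ) :
    ∃ g y, SmallNbr G x y ∧ FullExcept G K g x y ∧ Ext G x κ f g := by
  obtain ⟨g, hg, hext, hone⟩ := hf.exists_ext hG.deg hx κ
  obtain ⟨y, hy, hxy⟩ : ∃ y, SmallNbr G x y ∧ g x y = none := by
    obtain ⟨u, v, huv, h⟩ := hG.stuck g hg
    rcases hfull u v huv (hext.none u v h) with ⟨rfl, h1⟩ | ⟨rfl, h1⟩
    · exact ⟨v, h1, h⟩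
    · exact ⟨u, h1, by rw [hg.symm, h]⟩
  refine ⟨g, y, hy, ⟨hg, hxy, fun a b hab h => ?_⟩, hext⟩
  rcases hfull a b hab (hext.none a b h) with ⟨rfl, h1⟩ | ⟨rfl, h1⟩
  · exact .inl ⟨rfl, hone _ _ h1 hy h hxy⟩
  · exact .inr ⟨hone _ _ h1 hy (by rw [hg.symm, h]) hxy, rfl⟩

variable [DecidableEq V]

lemma Critical.two_le_degree (hG : Critical G K) (hxy : G.Adj x y) : 2 ≤ G.degree y := by
  by_contra hlt
  have hdeg : G.degree y ≤ 1 := by omega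
  have honly : ∀ z, G.Adj y z → z = x := by
    intro z hz
    rw [← card_neighborFinset_eq_degree] at hdeg
    exact Finset.card_le_one.1 hdeg _ (by simpa using hz) _ (by simpa using hxy.symm)
  obtain ⟨f, hf⟩ := hG.exists_fullExcept hxy
  obtain ⟨α, hα⟩ : (freeColors K f x).Nonempty := Finset.card_pos.1 (by
    have := hf.valid.two_le_card_freeColors hG.deg hxy hf.uncolored
    omega)
  rw [mem_freeColors] at hα
  have hy : ∀ β, Misses f y β := by
    intro β z hz
    obtain rfl := honly z (hf.valid.adj hz)
    rw [hf.valid.symm, hf.uncolored] at hz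
    cases hz
  obtain ⟨u, v, huv, h⟩ := hG.stuck _
    (hf.valid.color_of_disjoint hxy hα.1 hα.2 (hy α) fun β => .inr (hy β))
  have := hf.full u v huv
  grind [recolor]

lemma Critical.smallNbr_or (hG : Critical G K) (hxy : G.Adj x y) :
    SmallNbr G x y ∨ 3 ≤ G.degree y := by
  have := hG.two_le_degree hxy
  by_cases h : G.degree y = 2
  · exact .inl ⟨hxy, h⟩
  · right; omega

lemma FullExcept.stuck (hf : FullExcept G K f x y) (hG : Critical G K) (ε α : ℕ) :
    ¬ Valid G K (recolor (recolor f y y' (some ε)) x y (some α)) := by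
  intro h
  obtain ⟨u, v, huv, h'⟩ := hG.stuck _ h
  have := hf.full u v huv
  grind [recolor]

lemma FullExcept.big (hf : FullExcept G K f x y) (hG : Critical G K) (hx : FewBig G x)
    (hs : IsSmall G x y y') :
    (∃ z₁ z₂ a b, z₁ ≠ z₂ ∧ f x z₁ = some a ∧ f x z₂ = some b ∧ 3 ≤ G.degree z₁ ∧
      3 ≤ G.degree z₂ ∧ ∀ z, G.Adj x z → 3 ≤ G.degree z → z = z₁ ∨ z = z₂) ∧
    ∀ z ε, 3 ≤ G.degree z → f x z = some ε → (∀ t, t ≠ y → f y' t ≠ some ε) ∧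
      ∀ α ∈ freeColors K f x, (bichromatic (recolor f y y' (some ε)) α ε).Reachable x y :=
  hf.valid.big_of_stuck hG.deg hx hs hf.uncolored
    (hf.valid.two_le_card_freeColors hG.deg hs.adj hf.uncolored) subset_rfl
    fun ε α _ => hf.stuck hG ε α

/-- Uncolor all edges from `x` to neighbors of degree two. -/
def clear (G : SimpleGraph V) [DecidableRel G.Adj] (x : V) (f : V → V → Option ℕ) :
    V → V → Option ℕ :=
  fun u v => if (u = x ∧ G.degree v = 2) ∨ (v = x ∧ G.degree u = 2) then none else f u v

lemma Valid.clear (hf : Valid G K f) (x : V) : Valid G K (clear G x f) :=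
  hf.mono (by have := hf.symm; grind [AEC.clear]) (by grind [AEC.clear])

lemma FullExcept.reachable_clear (hf : FullExcept G K f x y) (hG : Critical G K) (hx : FewBig G x)
    (hs : IsSmall G x y y') {z : V} {ε γ : ℕ} (hz : 3 ≤ G.degree z) (hxz : f x z = some ε)
    (hγ : γ < K) (hγx : ∀ t, 3 ≤ G.degree t → f x t ≠ some γ) :
    (bichromatic (recolor (clear G x f) y y' (some ε)) γ ε).Reachable x y := by
  have hv := hf.valid
  have hsymm := hv.symm
  have hxy := hf.uncolored
  obtain ⟨-, hbig⟩ := hf.big hG hx hs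
  have hεK := hv.lt hxz
  have hne := hs.ne
  have hne1 := hs.adj.ne
  have hne2 := hs.adj'.ne
  have hzy : z ≠ y := by rintro rfl; grind
  obtain ⟨hfree, hreach⟩ := hbig z ε hz hxz
  have hg := hv.recolor_pendant hs hxy hεK hfree
  have hcv : ∀ t, f x t = some ε → t = z := fun t ht => hv.proper ht hxz
  have hγε : γ ≠ ε := fun h => hγx z hz (h ▸ hxz)
  have hle : ∀ c : V → V → Option ℕ, Valid G K c →
      (∀ u v δ, c u v = some δ → recolor f y y' (some ε) u v = some δ) →
      Misses c x γ → bichromatic c γ ε ≤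
        bichromatic (recolor (AEC.clear G x f) y y' (some ε)) γ ε := by
    intro c hc hcf hm u v huv
    rw [hc.bichromatic_adj] at huv
    rw [bichromatic, SimpleGraph.fromRel_adj]
    have hadj : G.Adj u v := huv.elim (fun h => hc.adj h) fun h => hc.adj h
    refine ⟨hadj.ne, .inl ?_⟩
    have h1 : u = x → v = z := by
      rintro rfl
      have h := hcf _ _ _ (huv.resolve_left (hm v))
      exact hcv v (by grind [recolor])
    have h2 : v = x → u = z := by
      rintro rfl
      have hm' := hm u
      rw [hc.symm] at hm'
      have h := hcf _ _ _ (huv.resolve_left hm')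
      exact hcv u (by grind [recolor])
    have h3 := hcf u v
    grind [recolor, AEC.clear]
  by_cases hm : Misses f x γ
  · refine (hreach γ (mem_freeColors.2 ⟨hγ, hm⟩)).mono (hle _ hg (fun _ _ _ h => h) ?_)
    intro t ht
    exact hm t (by grind [recolor])
  simp only [Misses] at hm
  push Not at hm
  obtain ⟨w, hw⟩ := hm
  have hws : SmallNbr G x w := (hG.smallNbr_or (hv.adj hw)).resolve_right fun h => hγx w h hw
  obtain ⟨w', hw'⟩ := hws.exists_isSmall
  have hwy : w ≠ y := by rintro rfl; grind
  have hwx := hw'.adj.ne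
  have hwx' := hw'.ne
  have hww' := hw'.adj'.ne
  have hzw : z ≠ w := by rintro rfl; grind
  set c₁ := recolor (recolor f y y' (some ε)) x w none with hc₁
  have hv₁ : Valid G K c₁ := hg.uncolor x w
  have hm₁ : Misses c₁ x γ := by
    intro t ht
    have : t ≠ w → f x t = some γ := by grind [recolor]
    have : t = w → False := by grind [recolor]
    have := @hv.proper x t w γ
    grind
  by_contra hno
  have hno₁ : ¬ (bichromatic c₁ γ ε).Reachable x y := fun h =>
    hno (h.mono (hle c₁ hv₁ (by grind [recolor]) hm₁))
  have hv₂ := hv₁.color_of_not_reachable hs (by grind [recolor]) (by grind [recolor]) hγ hγε hm₁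
    hno₁
  set c₂ := recolor c₁ x y (some γ) with hc₂
  have hf₂ : FullExcept G K c₂ x w := by
    refine ⟨hv₂, by grind [recolor], fun a b hab h => ?_⟩
    have := hf.full a b hab
    grind [recolor]
  obtain ⟨δ, hδ⟩ : ∃ δ, c₂ w w' = some δ := by
    rw [← Option.ne_none_iff_exists']
    intro h
    rcases hf₂.full w w' hw'.adj' h with h | h
    · exact hwx h.1.symm
    · exact hwx' h.2
  obtain ⟨⟨t, ht, ht3⟩, hr₂⟩ := hv₂.reachable_of_stuck hw' hf₂.uncolored
    (hv₂.two_le_card_freeColors hG.deg hw'.adj hf₂.uncolored) subset_rfl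
    (fun ε α _ => hf₂.stuck hG ε α) (hv₂.lt hδ)
    (fun s hs h => hs (hv₂.proper h (by rw [hv₂.symm, hδ])))
  rw [recolor_self hv₂.symm hδ] at hr₂
  have htf : f x t = some δ := by
    have : t ≠ y := by rintro rfl; have := hs.degree_eq; omega
    grind [recolor]
  have hγδ : γ ≠ δ := fun h => hγx t ht3 (h ▸ htf)
  obtain ⟨hfree', hreach'⟩ := hbig t δ ht3 htf
  have hg' := hv.recolor_pendant hs hxy (hv.lt htf) hfree'
  obtain ⟨α, hα⟩ : (freeColors K f x).Nonempty := Finset.card_pos.1 (by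
    have := hv.two_le_card_freeColors hG.deg hs.adj hxy
    omega)
  have hα' := mem_freeColors.1 hα
  have hαx := hα'.2
  simp only [Misses] at hαx
  have hαγ : α ≠ γ := fun h => hαx w (h ▸ hw)
  have hα₂ : α ∈ freeColors K c₂ x := by
    refine mem_freeColors.2 ⟨hα'.1, fun s h => ?_⟩
    have := hαx s
    grind [recolor]
  refine not_reachable_of_three_ends hg'.bichromatic_deg (hg'.bichromatic_end (α := α) ?_)
    (hg'.bichromatic_end_of_isSmall hs (by grind [recolor])) ?_ hne1 hwx hwy.symm
    (hreach' α hα) ((hr₂ α hα₂).mono ?_)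
  · intro s h
    have := hαx s
    grind [recolor]
  · have h : ∀ s, (bichromatic (recolor f y y' (some δ)) α δ).Adj w s → s = w' := by
      intro s hs
      rw [hg'.bichromatic_adj] at hs
      have hadj : G.Adj w s := by rcases hs with h | h <;> exact hg'.adj h
      refine (hw'.only s hadj).resolve_left ?_
      rintro rfl
      grind [recolor]
    intro a b ha hb
    rw [h a ha, h b hb]
  · intro u v huv
    rw [hv₂.bichromatic_adj] at huv
    rw [hg'.bichromatic_adj]
    grind [recolor]

end Critical

section Neighborhood

variable {V : Type*} [Fintype V] {G : SimpleGraph V} [DecidableRel G.Adj]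
  {K κ : ℕ} {f g : V → V → Option ℕ} {x y y' z z₁ z₂ : V} {a b γ ε : ℕ}

/-- `z₁` and `z₂` are distinct and are the only neighbors of `x` of degree at least three. -/
structure Bigs (G : SimpleGraph V) [DecidableRel G.Adj] (x z₁ z₂ : V) : Prop where
  ne : z₁ ≠ z₂
  adj₁ : G.Adj x z₁
  adj₂ : G.Adj x z₂
  deg₁ : 3 ≤ G.degree z₁
  deg₂ : 3 ≤ G.degree z₂
  only : ∀ z, G.Adj x z → 3 ≤ G.degree z → z = z₁ ∨ z = z₂

lemma Bigs.symm (h : Bigs G x z₁ z₂) : Bigs G x z₂ z₁ :=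
  ⟨h.ne.symm, h.adj₂, h.adj₁, h.deg₂, h.deg₁, fun z h1 h2 => (h.only z h1 h2).symm⟩

lemma Bigs.not_color (h : Bigs G x z₁ z₂) (hf : Valid G K f) (h1 : f x z₁ = some a)
    (h2 : f x z₂ = some b) (ha : γ ≠ a) (hb : γ ≠ b) (t : V) (ht : 3 ≤ G.degree t) :
    f x t ≠ some γ := by
  intro h'
  rcases h.only t (hf.adj h') ht with rfl | rfl <;> grind

variable [DecidableEq V]

lemma FullExcept.exists_path_start (hf : FullExcept G K f x y) (hG : Critical G K)
    (hx : FewBig G x) (hs : IsSmall G x y y') (hz : 3 ≤ G.degree z) (hxz : f x z = some ε)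
    (hγ : γ < K) (hγx : ∀ t, 3 ≤ G.degree t → f x t ≠ some γ) :
    ∃ u, f z u = some γ ∧ u ≠ x ∧ ¬ SmallNbr G x u ∧
      (u = y' ∨ ∃ t, t ≠ z ∧ t ≠ x ∧ ¬ SmallNbr G x t ∧ f u t = some ε) := by
  have hreach := hf.reachable_clear hG hx hs hz hxz hγ hγx
  have hv := hf.valid
  have hsymm := hv.symm
  have hadj := @hv.adj
  have hxy := hf.uncolored
  have hne := hs.ne
  have hne1 := hs.adj.ne
  have hne2 := hs.adj'.ne
  have hydeg := hs.degree_eq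
  have hfree := ((hf.big hG hx hs).2 z ε hz hxz).1
  have hc : ∀ u v δ, recolor (clear G x f) y y' (some ε) u v = some δ →
      (δ = ε ∧ (u = y ∧ v = y' ∨ u = y' ∧ v = y)) ∨ (f u v = some δ ∧
        ¬ (u = x ∧ G.degree v = 2) ∧ ¬ (v = x ∧ G.degree u = 2)) := by
    intro u v δ h
    grind [recolor, clear]
  have hcv : ∀ u v, (bichromatic (recolor (clear G x f) y y' (some ε)) γ ε).Adj u v →
      recolor (clear G x f) y y' (some ε) u v = some γ ∨
        recolor (clear G x f) y y' (some ε) u v = some ε := by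
    intro u v h
    rw [bichromatic, SimpleGraph.fromRel_adj] at h
    have := (hv.clear (G := G) x).symm u v
    grind [recolor]
  have hγε : γ ≠ ε := fun h => hγx z hz (h ▸ hxz)
  have hzx : z ≠ x := (hadj hxz).ne'
  have hzy : z ≠ y := by rintro rfl; omega
  have hzy' : z ≠ y' := by
    rintro rfl
    exact hfree x hne1 (by rw [hsymm, hxz])
  obtain ⟨v, hv1, hr⟩ := exists_reachAvoid_of_reachable hreach hne1
  have hvz : v = z := by
    rcases hcv _ _ hv1 with h | h
    · rcases hc _ _ _ h with h | h
      · grind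
      · have := hγx v
        have := hG.smallNbr_or (hadj h.1)
        unfold SmallNbr at this
        grind
    · rcases hc _ _ _ h with h | h
      · grind
      · exact hv.proper h.1 hxz
  subst hvz
  obtain ⟨u, hu, hux, hr⟩ := hr.next hzy
  have hvu : f v u = some γ := by
    rcases hcv _ _ hu with h | h
    · rcases hc _ _ _ h with h | h
      · grind
      · exact h.1
    · rcases hc _ _ _ h with h | h
      · grind
      · exact absurd (hv.proper h.1 (by rw [hsymm, hxz])) hux
  have huy : u ≠ y := by
    rintro rfl
    rcases hs.only v (hadj hvu).symm with h | h
    · exact hzx h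
    · exact hzy' h
  obtain ⟨t, ht, htv, hr⟩ := hr.next huy
  have hut : recolor (clear G x f) y y' (some ε) u t = some ε := by
    rcases hcv _ _ ht with h | h
    · rcases hc _ _ _ h with h' | h'
      · exact absurd h'.1 hγε
      · exact absurd (hv.proper h'.1 (by rw [hsymm, hvu])) htv
    · exact h
  have hut' : ∀ s, SmallNbr G x s → ∀ r q, G.Adj s r → G.Adj s q → r ≠ q → r ≠ x → q ≠ x →
      False := by
    intro s hs' r q h1 h2 hrq hr hq
    obtain ⟨s', hs''⟩ := hs'.exists_isSmall
    have := hs''.only r h1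
    have := hs''.only q h2
    grind
  have htx : t ≠ x := by
    rintro rfl
    rcases hc _ _ _ hut with h | h
    · grind
    · have h1 : f t u = some ε := by rw [hsymm, h.1]
      have := hv.proper h1 hxz
      subst this
      exact (hadj hvu).ne rfl
  have hadjut : G.Adj u t := by
    rcases hc _ _ _ hut with ⟨-, ⟨rfl, rfl⟩ | ⟨rfl, rfl⟩⟩ | h
    · exact hs.adj'
    · exact hs.adj'.symm
    · exact hadj h.1
  refine ⟨u, hvu, hux, fun h => hut' u h v t (hadj hvu).symm hadjut htv.symm hzx htx, ?_⟩
  by_cases huy' : u = y'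
  · exact .inl huy'
  have hty : t ≠ y := by
    rintro rfl
    rcases hs.only u hadjut.symm with h | h
    · exact hux h
    · exact huy' h
  refine .inr ⟨t, htv, htx, ?_, by grind⟩
  intro hts
  obtain ⟨s, hs1, hsu, -⟩ := hr.next hty
  have hsx : s ≠ x := by
    rintro rfl
    have := hts.2
    rcases hcv _ _ hs1 with h | h <;> rcases hc _ _ _ h with h | h <;> grind
  have hadjts : G.Adj t s := by
    rcases hcv _ _ hs1 with h | h
    · rcases hc _ _ _ h with h | h
      · grind
      · exact hadj h.1
    · rcases hc _ _ _ h with h | h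
      · grind
      · exact hadj h.1
  exact hut' t hts u s hadjut.symm hadjts hsu.symm hux hsx

lemma FullExcept.exists_path_end (hf : FullExcept G K f x y) (hG : Critical G K)
    (hx : FewBig G x) (hs : IsSmall G x y y') (hz : 3 ≤ G.degree z) (hxz : f x z = some ε)
    (hγ : γ < K) (hγx : ∀ t, 3 ≤ G.degree t → f x t ≠ some γ) :
    ∃ t s, t ≠ y ∧ f y' t = some γ ∧ f t s = some ε := by
  have hreach := (hf.reachable_clear hG hx hs hz hxz hγ hγx).symm
  have hv := hf.valid
  have hsymm := hv.symm
  have hadj := @hv.adj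
  have hxy := hf.uncolored
  have hne := hs.ne
  have hne1 := hs.adj.ne
  have hne2 := hs.adj'.ne
  have hydeg := hs.degree_eq
  have hfree := ((hf.big hG hx hs).2 z ε hz hxz).1
  have hγε : γ ≠ ε := fun h => hγx z hz (h ▸ hxz)
  have hc : ∀ u v, (bichromatic (recolor (clear G x f) y y' (some ε)) γ ε).Adj u v →
      (u = y ∧ v = y' ∨ u = y' ∧ v = y) ∨ ((f u v = some γ ∨ f u v = some ε) ∧
        ¬ (u = x ∧ G.degree v = 2) ∧ ¬ (v = x ∧ G.degree u = 2)) := by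
    intro u v h
    rw [bichromatic, SimpleGraph.fromRel_adj] at h
    have := hsymm u v
    grind [recolor, clear]
  obtain ⟨v, hv1, hr⟩ := exists_reachAvoid_of_reachable hreach hne1.symm
  have hvy' : v = y' := by
    rcases hc _ _ hv1 with h | h
    · grind
    · have := hs.only v (h.1.elim (fun h => hadj h) fun h => hadj h)
      grind
  subst hvy'
  obtain ⟨t, ht, hty, hr⟩ := hr.next hne
  have hvt : f v t = some γ := by
    have := hfree t hty
    have := hc _ _ ht
    grind
  have htx : t ≠ x := by
    rintro rfl
    have := hγx v
    have := hG.smallNbr_or (hadj hvt).symm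
    unfold SmallNbr at this
    have := hc _ _ ht
    have := hsymm v t
    grind
  obtain ⟨s, hs1, hsv, -⟩ := hr.next htx
  have htv := (hadj hvt).ne'
  refine ⟨t, s, hty, hvt, ?_⟩
  rcases hc _ _ hs1 with h | h
  · grind
  · refine h.1.resolve_left fun h => hsv (hv.proper h (by rw [hsymm, hvt]))

lemma FullExcept.le_degree_second (hf : FullExcept G K f x y) (hG : Critical G K)
    (hx : FewBig G x) (hs : IsSmall G x y y') (hb : Bigs G x z₁ z₂) (h1 : f x z₁ = some a)
    (h2 : f x z₂ = some b) : K ≤ G.degree y' + 1 := by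
  have hfree := ((hf.big hG hx hs).2 z₁ a hb.deg₁ h1).1
  have hg := hf.valid.recolor_pendant hs hf.uncolored (hf.valid.lt h1) hfree
  refine (hg.misses_of_all hG.deg (v := y') (a := b) fun γ hγ hγb => ?_).2
  by_cases hγa : γ = a
  · subst hγa
    exact ⟨y, by simp [recolor]⟩
  · obtain ⟨t, s, hty, ht, -⟩ := hf.exists_path_end hG hx hs hb.deg₁ h1 hγ
      (hb.not_color hf.valid h1 h2 hγa hγb)
    exact ⟨t, by grind [recolor, hs.adj'.ne]⟩

lemma FullExcept.misses (hf : FullExcept G K f x y) (hG : Critical G K)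
    (hx : FewBig G x) (hs : IsSmall G x y y') (hb : Bigs G x z₁ z₂) (h1 : f x z₁ = some a)
    (h2 : f x z₂ = some b) : Misses f z₁ b ∧ K ≤ G.degree z₁ + 1 := by
  refine hf.valid.misses_of_all hG.deg fun γ hγ hγb => ?_
  by_cases hγa : γ = a
  · subst hγa
    exact ⟨x, by rw [hf.valid.symm, h1]⟩
  · obtain ⟨u, hu, -⟩ := hf.exists_path_start hG hx hs hb.deg₁ h1 hγ
      (hb.not_color hf.valid h1 h2 hγa hγb)
    exact ⟨u, hu⟩

lemma Bigs.exists_swap (hb : Bigs G x z₁ z₂) (hG : Critical G K) (hf : Valid G K f)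
    (h1 : f x z₁ = some a) (h2 : f x z₂ = some b) (hm1 : Misses f z₁ b) (hm2 : Misses f z₂ a) :
    ∃ g, Valid G K g ∧ g x z₁ = some b ∧ g x z₂ = some a ∧
      (∀ u v, u ≠ x → v ≠ x → g u v = f u v) ∧ ∀ t, SmallNbr G x t → g x t = none := by
  have hsymm := hf.symm
  have hne := hb.ne
  have hne1 := hb.adj₁.ne
  have hne2 := hb.adj₂.ne
  have hd1 := hb.deg₁
  have hd2 := hb.deg₂
  have hab : a ≠ b := by
    rintro rfl
    exact hne (hf.proper h1 h2)
  have hv := ((hf.clear (G := G) x).uncolor x z₁).uncolor x z₂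
  set c := recolor (recolor (clear G x f) x z₁ none) x z₂ none with hc
  have hcf : ∀ u v γ, c u v = some γ → f u v = some γ ∧ u ≠ x ∧ v ≠ x := by
    intro u v γ h
    have h' : f u v = some γ := by grind [recolor, clear]
    have hu : u = x → SmallNbr G x v ∨ v = z₁ ∨ v = z₂ := by
      rintro rfl
      exact (hG.smallNbr_or (hf.adj h')).imp_right (hb.only v (hf.adj h'))
    have hv : v = x → SmallNbr G x u ∨ u = z₁ ∨ u = z₂ := by
      rintro rfl
      exact (hG.smallNbr_or (hf.adj h').symm).imp_right (hb.only u (hf.adj h').symm)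
    unfold SmallNbr at hu hv
    grind [recolor, clear]
  have hcx : ∀ γ, Misses c x γ := fun γ t h => (hcf _ _ _ h).2.1 rfl
  have hc1 : Misses c z₁ b := fun t h => hm1 t (hcf _ _ _ h).1
  have hc2 : Misses c z₂ a := fun t h => hm2 t (hcf _ _ _ h).1
  have hv1 := hv.color_of_disjoint hb.adj₁ (hf.lt h2) (hcx b) hc1 fun β => .inl (hcx β)
  have hc2' : Misses c z₂ b := by
    intro t h
    obtain ⟨h, -, h'⟩ := hcf _ _ _ h
    exact h' (hf.proper h (by rw [hsymm, h2]))
  have hx1 : ∀ t β, recolor c x z₁ (some b) x t = some β → β = b := by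
    intro t β h
    have := hcx β t
    grind [recolor]
  have hv2 := hv1.color_of_disjoint hb.adj₂ (hf.lt h1) (fun t h => hab (hx1 t a h))
    (fun t h => hc2 t (by grind [recolor])) fun β => by
      by_cases hβ : β = b
      · right
        intro t h
        exact hc2' t (by grind [recolor])
      · exact .inl fun t h => hβ (hx1 t β h)
  refine ⟨_, hv2, by grind [recolor], by grind [recolor], ?_, fun t ht => ?_⟩
  · intro u v hu hv
    grind [recolor, clear]
  · unfold SmallNbr at ht
    grind [recolor, clear]

end Neighborhood

section BigNeighbors

variable {V : Type*} [Fintype V] {G : SimpleGraph V} [DecidableRel G.Adj]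
  {K κ : ℕ} {f g : V → V → Option ℕ} {x y y' z z₁ z₂ : V} {a b γ ε : ℕ}

lemma Bigs.not_smallNbr_left (hb : Bigs G x z₁ z₂) : ¬ SmallNbr G x z₁ := fun h => by
  have := hb.deg₁
  have := h.2
  omega

lemma not_smallNbr_self (x : V) : ¬ SmallNbr G x x := fun h => h.1.ne rfl

variable [DecidableEq V]

lemma FullExcept.exists_bigs (hf : FullExcept G K f x y) (hG : Critical G K)
    (hx : FewBig G x) (hs : IsSmall G x y y') :
    ∃ z₁ z₂ a b, Bigs G x z₁ z₂ ∧ f x z₁ = some a ∧ f x z₂ = some b := by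
  obtain ⟨⟨z₁, z₂, a, b, hne, h1, h2, hd1, hd2, honly⟩, -⟩ := hf.big hG hx hs
  exact ⟨z₁, z₂, a, b, ⟨hne, hf.valid.adj h1, hf.valid.adj h2, hd1, hd2, honly⟩, h1, h2⟩

lemma FullExcept.degree_of_big (hf : FullExcept G K f x y) (hG : Critical G K)
    (hx : FewBig G x) (hs : IsSmall G x y y') (hb : Bigs G x z₁ z₂) (h1 : f x z₁ = some a)
    (h2 : f x z₂ = some b) :
    K ≤ G.degree z₁ + 1 ∧ ∀ u, G.Adj z₁ u → 3 ≤ G.degree u := by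
  obtain ⟨hm1, hK⟩ := hf.misses hG hx hs hb h1 h2
  obtain ⟨hm2, -⟩ := hf.misses hG hx hs hb.symm h2 h1
  refine ⟨hK, fun u hu => ?_⟩
  have hv := hf.valid
  have hsymm := hv.symm
  have hxz := hb.adj₁.ne
  have hd1 := hb.deg₁
  have hydeg := hs.degree_eq
  have hy1 : y ≠ z₁ := by rintro rfl; omega
  have hy2 : y ≠ z₂ := by rintro rfl; have := hb.deg₂; omega
  by_cases hux : u = x
  · subst hux
    exact three_le_degree hb.adj₁ hb.adj₂ hs.adj hb.ne hy1.symm hy2.symm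
  obtain ⟨γ, hγ⟩ : ∃ γ, f z₁ u = some γ := by
    rw [← Option.ne_none_iff_exists']
    intro h
    have := hf.full _ _ hu h
    grind
  have hγK := hv.lt hγ
  have hγa : γ ≠ a := by
    rintro rfl
    exact hux (hv.proper hγ (by rw [hsymm, h1]))
  have hγb : γ ≠ b := by
    rintro rfl
    exact hm1 u hγ
  have hab : a ≠ b := by
    rintro rfl
    exact hb.ne (hv.proper h1 h2)
  obtain ⟨u', hu', -, hus, h⟩ := hf.exists_path_start hG hx hs hb.deg₁ h1 hγK
    (hb.not_color hv h1 h2 hγa hγb)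
  obtain rfl := hv.proper hγ hu'
  rcases h with rfl | ⟨t, htz, htx, hts, ht⟩
  · have := hf.le_degree_second hG hx hs hb h1 h2
    have := hG.deg z₁
    omega
  obtain ⟨f₁, hv₁, h1', h2', hagree, hnone⟩ := hb.exists_swap hG hv h1 h2 hm1 hm2
  obtain ⟨f₂, w, hw, hf₂, hext⟩ := hG.exists_fullExcept_ext hx hv₁ (by
    intro r q hrq h
    have hcase : ∀ q, G.Adj x q → f₁ x q = none → SmallNbr G x q := by
      intro q hq h
      refine (hG.smallNbr_or hq).resolve_right fun h3 => ?_
      rcases hb.only q hq h3 with rfl | rfl <;> grind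
    by_cases hrx : r = x
    · subst hrx
      exact .inl ⟨rfl, hcase q hrq h⟩
    by_cases hqx : q = x
    · subst hqx
      exact .inr ⟨rfl, hcase r hrq.symm (by rw [hv₁.symm, h])⟩
    rw [hagree r q hrx hqx] at h
    have := hf.full r q hrq h
    grind) K
  have hz1s := hb.not_smallNbr_left
  have hz2s := hb.symm.not_smallNbr_left
  have hxs := not_smallNbr_self (G := G) x
  obtain ⟨w', hw'⟩ := hw.exists_isSmall
  have h1'' : f₂ x z₁ = some b := by rw [hext.agree _ _ hxs hz1s, h1']
  have h2'' : f₂ x z₂ = some a := by rw [hext.agree _ _ hxs hz2s, h2']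
  obtain ⟨u', hu', hux', hus', h⟩ := hf₂.exists_path_start hG hx hw' hb.deg₁ h1'' hγK
    (hb.not_color hf₂.valid h1'' h2'' hγb hγa)
  rw [hext.agree _ _ hz1s hus', hagree _ _ hxz.symm hux'] at hu'
  obtain rfl := hv.proper hγ hu'
  rcases h with rfl | ⟨s, hsz, hsx, hss, hs'⟩
  · have := hf₂.le_degree_second hG hx hw' hb h1'' h2''
    have := hG.deg z₁
    omega
  rw [hext.agree _ _ hus hss, hagree _ _ hux hsx] at hs'
  refine three_le_degree hu.symm (hv.adj ht) (hv.adj hs') htz.symm hsz.symm ?_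
  rintro rfl
  rw [ht] at hs'
  exact hab (Option.some.inj hs')

/-- A vertex with a neighbor of degree two and at most two neighbors of larger degree has exactly
two neighbors of larger degree; these have almost maximal degree and no neighbor of degree two. -/
lemma Critical.exists_bigs (hG : Critical G K) (hx : FewBig G x) (hy : SmallNbr G x y) :
    ∃ z₁ z₂, Bigs G x z₁ z₂ ∧ ∀ z, G.Adj x z → 3 ≤ G.degree z →
      K ≤ G.degree z + 1 ∧ ∀ u, G.Adj z u → 3 ≤ G.degree u := by
  obtain ⟨y', hs⟩ := hy.exists_isSmall
  obtain ⟨f, hf⟩ := hG.exists_fullExcept hs.adj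
  obtain ⟨z₁, z₂, a, b, hb, h1, h2⟩ := hf.exists_bigs hG hx hs
  refine ⟨z₁, z₂, hb, fun z hz hz3 => ?_⟩
  rcases hb.only z hz hz3 with rfl | rfl
  · exact hf.degree_of_big hG hx hs hb h1 h2
  · exact hf.degree_of_big hG hx hs hb.symm h2 h1

/-- The other neighbor of a neighbor of `x` of degree two is not adjacent to a neighbor of `x` of
larger degree. -/
lemma Critical.not_adj_second (hG : Critical G K) (hx : FewBig G x) (hs : IsSmall G x y y')
    (hz : G.Adj x z) (hz3 : 3 ≤ G.degree z) : ¬ G.Adj y' z := by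
  obtain ⟨f, hf⟩ := hG.exists_fullExcept hs.adj
  obtain ⟨z₁, z₂, a, b, hb, h1, h2, rfl⟩ : ∃ z₁ z₂ a b, Bigs G x z₁ z₂ ∧ f x z₁ = some a ∧
      f x z₂ = some b ∧ z = z₁ := by
    obtain ⟨z₁, z₂, a, b, hb, h1, h2⟩ := hf.exists_bigs hG hx hs
    rcases hb.only z hz hz3 with h | h
    · exact ⟨z₁, z₂, a, b, hb, h1, h2, h⟩
    · exact ⟨z₂, z₁, b, a, hb.symm, h2, h1, h⟩
  intro hadj
  have hv := hf.valid
  have hxz := hb.adj₁.ne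
  obtain ⟨hm1, -⟩ := hf.misses hG hx hs hb h1 h2
  have hydeg := hs.degree_eq
  have hzy : z ≠ y := by rintro rfl; omega
  obtain ⟨γ, hγ⟩ : ∃ γ, f y' z = some γ := by
    rw [← Option.ne_none_iff_exists']
    intro h
    have := hf.full _ _ hadj h
    grind
  have hγa : γ ≠ a := by
    rintro rfl
    exact ((hf.big hG hx hs).2 z γ hz3 h1).1 z hzy hγ
  have hγb : γ ≠ b := by
    rintro rfl
    exact hm1 y' (by rw [hv.symm, hγ])
  obtain ⟨t, s, -, ht, hts⟩ := hf.exists_path_end hG hx hs hb.deg₂ h2 (hv.lt hγ)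
    (hb.not_color hv h1 h2 hγa hγb)
  obtain rfl := hv.proper hγ ht
  exact hm1 s hts

lemma Critical.misses_of_base (hG : Critical G K) (hx : FewBig G x) (hf : Valid G K f)
    (hfull : ∀ a b, G.Adj a b → f a b = none →
      (a = x ∧ SmallNbr G x b) ∨ (b = x ∧ SmallNbr G x a))
    (hb : Bigs G x z₁ z₂) (h1 : f x z₁ = some a) (h2 : f x z₂ = some b)
    (hz : ∀ u, G.Adj z₁ u → 3 ≤ G.degree u) :
    Misses f z₁ b ∧ ∀ γ < K, γ ≠ a → γ ≠ b → ∃ u, f z₁ u = some γ := by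
  obtain ⟨g, y, hy, hg, hext⟩ := hG.exists_fullExcept_ext hx hf hfull K
  obtain ⟨y', hs⟩ := hy.exists_isSmall
  have hz1s := hb.not_smallNbr_left
  have hz2s := hb.symm.not_smallNbr_left
  have hxs := not_smallNbr_self (G := G) x
  have h1' : g x z₁ = some a := by rw [hext.agree _ _ hxs hz1s, h1]
  have h2' : g x z₂ = some b := by rw [hext.agree _ _ hxs hz2s, h2]
  have hagree : ∀ u, G.Adj z₁ u → g z₁ u = f z₁ u := fun u hu =>
    hext.agree _ _ hz1s fun h => by
      have := hz u hu
      have := h.2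
      omega
  refine ⟨fun u hu => ?_, fun γ hγ ha hb' => ?_⟩
  · refine (hg.misses hG hx hs hb h1' h2').1 u ?_
    rw [hagree u (hf.adj hu), hu]
  · obtain ⟨u, hu, -⟩ := hg.exists_path_start hG hx hs hb.deg₁ h1' hγ
      (hb.not_color hg.valid h1' h2' ha hb')
    exact ⟨u, by rw [← hagree u (hg.valid.adj hu), hu]⟩

/-- All edges from `x` to neighbors of degree two can be colored if a color `κ` is available at `x`
which cannot continue the critical paths through a neighbor `z` of large degree. -/
lemma Valid.exists_complete (hf : Valid G K f) (hG : Critical G K) (hx : FewBig G x) (hκ : κ < K)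
    (hm : Misses f x κ) (hz3 : 3 ≤ G.degree z) (hxz : f x z = some ε)
    (hz : ∀ u, G.Adj z u → 3 ≤ G.degree u)
    (hu : ∀ u, f z u = some κ → Misses f u ε ∧ ∀ w, SmallNbr G x w → ¬ G.Adj u w) :
    ∃ g, Valid G K g ∧ (∀ u v, ¬ SmallNbr G x u → ¬ SmallNbr G x v → g u v = f u v) ∧
      (∀ u v, g u v = none → f u v = none) ∧ ∀ w, SmallNbr G x w → g x w ≠ none := by
  obtain ⟨g, hg, hext, hone⟩ := hf.exists_ext hG.deg hx κ
  by_cases hall : ∀ w, SmallNbr G x w → g x w ≠ none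
  · exact ⟨g, hg, hext.agree, hext.none, hall⟩
  push Not at hall
  obtain ⟨y, hy, hxy⟩ := hall
  obtain ⟨y', hs⟩ := hy.exists_isSmall
  by_cases hcol : ∃ ε α, Valid G K (recolor (recolor g y y' (some ε)) x y (some α))
  · obtain ⟨δ, α, hv⟩ := hcol
    refine ⟨_, hv, fun u v hu hv => ?_, fun u v h => ?_, fun w hw => ?_⟩
    · rw [← hext.agree u v hu hv]
      grind [recolor]
    · refine hext.none u v ?_
      grind [recolor]
    · have := hone w y hw hy
      have := hs.ne
      have := hs.adj.ne
      grind [recolor]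
  push Not at hcol
  exfalso
  have hzs : ¬ SmallNbr G x z := fun h => by
    have := h.2
    omega
  have hxs := not_smallNbr_self (G := G) x
  have hxz' : g x z = some ε := by rw [hext.agree _ _ hxs hzs, hxz]
  have hgm : Misses g x κ := fun t ht => by
    rcases hext.new t κ ht with h | h
    · exact hm t h
    · exact h.2 rfl
  obtain ⟨hfree, hreach⟩ := (hg.big_of_stuck hG.deg hx hs hxy
    (hg.two_le_card_freeColors hG.deg hs.adj hxy) subset_rfl fun ε α _ => hcol ε α).2 z ε hz3 hxz'
  have hreach := hreach κ (mem_freeColors.2 ⟨hκ, hgm⟩)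
  have hv := hg.recolor_pendant hs hxy (hg.lt hxz') hfree
  have hadj := @hg.adj
  have hne := hs.ne
  have hne1 := hs.adj.ne
  have hne2 := hs.adj'.ne
  have hsymm := hg.symm
  have hydeg := hs.degree_eq
  have hzy : z ≠ y := by rintro rfl; omega
  have hzx : z ≠ x := (hadj hxz').ne'
  have hzy' : z ≠ y' := by
    rintro rfl
    exact hfree x hne1 (by rw [hsymm, hxz'])
  obtain ⟨v, hv1, hr⟩ := exists_reachAvoid_of_reachable hreach hne1
  rw [hv.bichromatic_adj] at hv1
  have hvz : v = z := by
    have := hgm v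
    have hvε : g x v = some ε := by grind [recolor]
    exact hg.proper hvε hxz'
  subst hvz
  obtain ⟨u, hu1, hux, hr⟩ := hr.next hzy
  rw [hv.bichromatic_adj] at hu1
  have hvu : g v u = some κ := by
    have : g v u = some κ ∨ g v u = some ε := by grind [recolor]
    exact this.resolve_right fun h => hux (hg.proper h (by rw [hsymm, hxz']))
  have hus : ¬ SmallNbr G x u := fun h => by
    have := hz u (hadj hvu)
    have := h.2
    omega
  rw [hext.agree _ _ hzs hus] at hvu
  obtain ⟨hmu, hnadj⟩ := hu u hvu
  have huy : u ≠ y := fun h => hus (h ▸ hy)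
  obtain ⟨t, ht, htv, -⟩ := hr.next huy
  have hadjut : G.Adj u t := by
    rw [hv.bichromatic_adj] at ht
    rcases ht with h | h <;> exact hv.adj h
  have hts : ¬ SmallNbr G x t := fun h => hnadj t h hadjut
  rw [hv.bichromatic_adj] at ht
  have hty : t ≠ y := fun h => hts (h ▸ hy)
  have hut : g u t = some κ ∨ g u t = some ε := by grind [recolor]
  rw [hext.agree _ _ hus hts] at hut
  rcases hut with h | h
  · exact htv (hf.proper h (by rw [hf.symm, hvu]))
  · exact hmu t h

end BigNeighbors

section Final

variable {V : Type*} [Fintype V] [DecidableEq V] {G : SimpleGraph V} [DecidableRel G.Adj]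
  {K : ℕ} {f d : V → V → Option ℕ} {x y z q x₁ x₂ p₁ p₂ : V} {a b γ ρ : ℕ}

lemma Critical.four_lt (hG : Critical G K) (hx : FewBig G x) (hy : SmallNbr G x y) : 4 < K := by
  by_contra hK
  obtain ⟨y', hs⟩ := hy.exists_isSmall
  obtain ⟨f, hf⟩ := hG.exists_fullExcept hs.adj
  obtain ⟨z₁, z₂, a, b, hb, h1, h2⟩ := hf.exists_bigs hG hx hs
  obtain ⟨hm1, -⟩ := hf.misses hG hx hs hb h1 h2
  obtain ⟨hm2, -⟩ := hf.misses hG hx hs hb.symm h2 h1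
  obtain ⟨g, hg, h1', h2', hagree, hnone⟩ := hb.exists_swap hG hf.valid h1 h2 hm1 hm2
  have hv := hf.valid
  have hxy := hf.uncolored
  have hydeg := hs.degree_eq
  have hy1 : y ≠ z₁ := by rintro rfl; have := hb.deg₁; omega
  have hy2 : y ≠ z₂ := by rintro rfl; have := hb.deg₂; omega
  have hx1 := hb.adj₁.ne
  have hx2 := hb.adj₂.ne
  have hsx := hs.adj.ne
  have hne := hs.ne
  have hne2 := hs.adj'.ne
  have hnbr : ∀ t, G.Adj x t → t = z₁ ∨ t = z₂ ∨ t = y := by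
    intro t ht
    by_contra! hcon
    have hsub : ({z₁, z₂, y, t} : Finset V) ⊆ G.neighborFinset x := by
      intro s hs'
      have := hb.adj₁
      have := hb.adj₂
      have := hs.adj
      rw [mem_neighborFinset]
      simp at hs'
      grind
    have hcard := Finset.card_le_card hsub
    have h4 : ({z₁, z₂, y, t} : Finset V).card = 4 := by
      have := hb.ne
      rw [Finset.card_insert_of_notMem, Finset.card_insert_of_notMem,
        Finset.card_insert_of_notMem, Finset.card_singleton] <;> simp <;> grind
    rw [h4, card_neighborFinset_eq_degree] at hcard
    have := hG.deg x
    omega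
  have hgf : FullExcept G K g x y := by
    refine ⟨hg, hnone y hy, fun u v huv h => ?_⟩
    have hend : ∀ t, G.Adj x t → g x t = none → t = y := by
      intro t ht hgt
      rcases hnbr t ht with rfl | rfl | rfl
      · rw [h1'] at hgt
        cases hgt
      · rw [h2'] at hgt
        cases hgt
      · rfl
    by_cases hu : u = x
    · subst hu
      exact .inl ⟨rfl, hend v huv h⟩
    by_cases hv : v = x
    · subst hv
      exact .inr ⟨hend u huv.symm (by rw [hg.symm, h]), rfl⟩
    rw [hagree u v hu hv] at h
    exact hf.full u v huv h
  obtain ⟨α, hα⟩ : (freeColors K f x).Nonempty := Finset.card_pos.1 (by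
    have := hv.two_le_card_freeColors hG.deg hs.adj hxy
    omega)
  obtain ⟨hαK, hαm⟩ := mem_freeColors.1 hα
  have hαa : α ≠ a := fun h => hαm z₁ (h ▸ h1)
  have hαb : α ≠ b := fun h => hαm z₂ (h ▸ h2)
  have hαg : Misses g x α := by
    intro t ht
    rcases hnbr t (hg.adj ht) with rfl | rfl | rfl
    · grind
    · grind
    · rw [hgf.uncolored] at ht
      cases ht
  obtain ⟨hfree, hreach⟩ := (hf.big hG hx hs).2 z₁ a hb.deg₁ h1
  have hfree₂ := ((hf.big hG hx hs).2 z₂ b hb.deg₂ h2).1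
  have hr₂ := ((hgf.big hG hx hs).2 z₂ a hb.deg₂ h2').2 α (mem_freeColors.2 ⟨hαK, hαg⟩)
  have hvf := hv.recolor_pendant hs hxy (hv.lt h1) hfree
  have hvg := hg.recolor_pendant hs hgf.uncolored (hv.lt h1)
    ((hgf.big hG hx hs).2 z₂ a hb.deg₂ h2').1
  have hy'2 : z₂ ≠ y' := by
    rintro rfl
    exact hfree₂ x hsx (by rw [hv.symm, h2])
  obtain ⟨v, hv1, hr⟩ := exists_reachAvoid_of_reachable hr₂ hsx
  have hv2 : v = z₂ := by
    rw [hvg.bichromatic_adj] at hv1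
    have := hαg v
    have hva : g x v = some a := by grind [recolor]
    exact hg.proper hva h2'
  subst hv2
  have hr' := hr.reachable_of_imp (H' := bichromatic (recolor f y y' (some a)) α a) (by
    intro u w hu hw huw
    rw [hvg.bichromatic_adj] at huw
    rw [hvf.bichromatic_adj]
    have := hagree u w hu hw
    grind [recolor])
  refine not_reachable_of_three_ends hvf.bichromatic_deg (hvf.bichromatic_end (α := α) ?_)
    (hvf.bichromatic_end_of_isSmall hs (by grind [recolor])) ?_ hsx hx2 hy2
    (hreach α hα) ((hreach α hα).trans hr'.symm)
  · intro t ht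
    have := hαm t
    grind [recolor]
  · rw [bichromatic_comm]
    refine hvf.bichromatic_end fun t ht => ?_
    have := hm2 t
    grind [recolor]

lemma Critical.false_of_coloring (hG : Critical G K) (hx₁ : FewBig G x₁) (hx₂ : FewBig G x₂)
    (hb₁ : Bigs G x₁ q p₁) (hb₂ : Bigs G x₂ q p₂) (hq : ∀ u, G.Adj q u → 3 ≤ G.degree u)
    (hp₁ : ∀ u, G.Adj p₁ u → 3 ≤ G.degree u) (hp₂ : ∀ u, G.Adj p₂ u → 3 ≤ G.degree u)
    (hx : x₁ ≠ x₂) (hadj : ¬ G.Adj x₁ x₂) (hpx₁ : p₁ ≠ x₂) (hpx₂ : p₂ ≠ x₁)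
    (hsmall : ∀ w, SmallNbr G x₁ w → ¬ G.Adj x₂ w)
    (hd : Valid G K d) (h1 : d x₁ q = some a) (h2 : d x₁ p₁ = some b) (haρ : a ≠ ρ)
    (hmq : Misses d q b) (hmp : Misses d p₁ a) (hγ : d q x₂ = some γ) (hρ : d x₂ p₂ = some ρ)
    (hn₁ : ∀ w, SmallNbr G x₁ w → d x₁ w = none) (hn₂ : ∀ w, SmallNbr G x₂ w → d x₂ w = none)
    (hfull : ∀ u v, G.Adj u v → d u v = none → (u = x₁ ∧ SmallNbr G x₁ v) ∨
      (v = x₁ ∧ SmallNbr G x₁ u) ∨ (u = x₂ ∧ SmallNbr G x₂ v) ∨ (v = x₂ ∧ SmallNbr G x₂ u)) :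
    False := by
  have hsymm := hd.symm
  have hnbr₁ : ∀ t δ, d x₁ t = some δ → t = q ∨ t = p₁ := by
    intro t δ ht
    rcases hG.smallNbr_or (hd.adj ht) with h | h
    · rw [hn₁ t h] at ht
      cases ht
    · exact hb₁.only t (hd.adj ht) h
  have hnbr₂ : ∀ t δ, d x₂ t = some δ → t = q ∨ t = p₂ := by
    intro t δ ht
    rcases hG.smallNbr_or (hd.adj ht) with h | h
    · rw [hn₂ t h] at ht
      cases ht
    · exact hb₂.only t (hd.adj ht) h
  have hγa : γ ≠ a := by
    rintro rfl
    exact hx (hd.proper (by rw [hsymm, h1]) hγ)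
  have hγb : γ ≠ b := by
    rintro rfl
    exact hmq _ hγ
  have hab : a ≠ b := by
    rintro rfl
    exact hb₁.ne (hd.proper h1 h2)
  have hqx₁ := hb₁.adj₁.ne'
  have hqx₂ := hb₂.adj₁.ne'
  have hpx₁' := hb₁.adj₂.ne'
  have hpx₂' := hb₂.adj₂.ne'
  have hpq₁ := hb₁.ne
  have hpq₂ := hb₂.ne
  have hbase : ∀ c g : V → V → Option ℕ, Valid G K g → (∀ u v, c u v = none → d u v = none) →
      (∀ u v, g u v = none → c u v = none) → (∀ w, SmallNbr G x₁ w → g x₁ w ≠ none) →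
      ∀ u v, G.Adj u v → g u v = none →
        (u = x₂ ∧ SmallNbr G x₂ v) ∨ (v = x₂ ∧ SmallNbr G x₂ u) := by
    intro c g hg hcd hgc hall u v huv h
    rcases hfull u v huv (hcd u v (hgc u v h)) with ⟨rfl, h'⟩ | ⟨rfl, h'⟩ | h' | h'
    · exact absurd h (hall v h')
    · exact absurd (by rw [hg.symm, h]) (hall u h')
    · exact .inl h'
    · exact .inr h'
  have hbig : ∀ w, 3 ≤ G.degree w → ¬ SmallNbr G x₁ w := fun w hw h => by
    have := h.2
    omega
  have hx₂s : ¬ SmallNbr G x₁ x₂ := fun h => hadj h.1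
  have hqs := hbig q hb₁.deg₁
  have hp₂s := hbig p₂ hb₂.deg₂
  obtain ⟨g, hg, hagree, hnone, hall⟩ := hd.exists_complete hG hx₁ (hd.lt hγ) (fun t ht => by
    have := hnbr₁ t γ ht
    grind) hb₁.deg₁ h1 hq (fun u hu => by
    obtain rfl := hd.proper hγ hu
    refine ⟨fun t ht => ?_, hsmall⟩
    have := hnbr₂ t a ht
    grind)
  have hgbase := hbase d g hg (fun _ _ h => h) hnone hall
  have hgq : g x₂ q = some γ := by rw [hagree _ _ hx₂s hqs, hsymm, hγ]
  have hgp : g x₂ p₂ = some ρ := by rw [hagree _ _ hx₂s hp₂s, hρ]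
  obtain ⟨-, hq'⟩ := hG.misses_of_base hx₂ hg hgbase hb₂ hgq hgp hq
  have hρb : b = ρ := by
    by_contra hne
    obtain ⟨u, hu⟩ := hq' b (hd.lt h2) hγb.symm hne
    refine hmq u ?_
    rw [← hagree q u hqs (hbig u (hq u (hg.adj hu))), hu]
  subst hρb
  have hp₂γ : Misses d p₂ γ := by
    intro u hu
    refine (hG.misses_of_base hx₂ hg hgbase hb₂.symm hgp hgq hp₂).1 u ?_
    rw [hagree p₂ u hp₂s (hbig u (hp₂ u (hd.adj hu))), hu]
  have hv := (hd.uncolor q x₁).uncolor q x₂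
  set c := recolor (recolor d q x₁ none) q x₂ none with hc
  have hc₁ : ∀ t δ, c x₁ t = some δ → δ = b := by
    intro t δ ht
    have := hnbr₁ t δ
    grind [recolor]
  have hc₂ : ∀ t δ, c x₂ t = some δ → δ = b := by
    intro t δ ht
    have := hnbr₂ t δ
    grind [recolor]
  have hcq : ∀ t δ, c q t = some δ → d q t = some δ ∧ t ≠ x₁ ∧ t ≠ x₂ := by
    grind [recolor]
  have hv₁ := hv.color_of_disjoint hb₁.adj₁.symm (hd.lt hγ)
    (fun t ht => (hcq t γ ht).2.2 (hd.proper (hcq t γ ht).1 hγ))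
    (fun t ht => hγb (hc₁ t γ ht)) fun β => by
      by_cases hβ : β = b
      · exact .inl fun t ht => hmq t (hβ ▸ (hcq t β ht).1)
      · exact .inr fun t ht => hβ (hc₁ t β ht)
  have hv₂ := hv₁.color_of_disjoint hb₂.adj₁.symm (hd.lt h1)
    (fun t ht => by
      have h3 := hcq t a
      have h4 : d q t = some a → t = x₁ := fun h => hd.proper h (by rw [hsymm, h1])
      grind [recolor])
    (fun t ht => hab (hc₂ t a (by grind [recolor]))) fun β => by
      by_cases hβ : β = b
      · left
        intro t ht
        have h3 := hcq t β
        have h4 := hmq t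
        grind [recolor]
      · exact .inr fun t ht => hβ (hc₂ t β (by grind [recolor]))
  set e := recolor (recolor c q x₁ (some γ)) q x₂ (some a) with he
  have hex₁ : ∀ t, t ≠ q → e x₁ t = d x₁ t := by grind [recolor]
  have heq : e x₁ q = some γ := by grind [recolor]
  have hep : ∀ u v, u ≠ q → u ≠ x₁ → u ≠ x₂ → e u v = d u v := by grind [recolor]
  have hed : ∀ u v, e u v = none → d u v = none := by grind [recolor]
  obtain ⟨g', hg', hagree', hnone', hall'⟩ := hv₂.exists_complete (κ := a) (z := p₁) (ε := b) hG hx₁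
    (hd.lt h1) (fun t ht => by
      by_cases htq : t = q
      · rw [htq, heq] at ht
        exact hγa (Option.some.inj ht)
      rw [hex₁ t htq] at ht
      rcases hnbr₁ t a ht with rfl | rfl
      · exact htq rfl
      · exact hab (Option.some.inj (ht.symm.trans h2))) hb₁.deg₂
    (by rw [hex₁ _ hpq₁.symm, h2]) hp₁ (fun u hu => by
      rw [hep p₁ u hpq₁.symm hpx₁' hpx₁] at hu
      exact absurd hu (hmp u))
  have hgq' : g' x₂ q = some a := by
    rw [hagree' _ _ hx₂s hqs]
    grind [recolor]
  have hgp' : g' x₂ p₂ = some b := by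
    rw [hagree' _ _ hx₂s hp₂s]
    grind [recolor]
  obtain ⟨u, hu⟩ := (hG.misses_of_base hx₂ hg' (hbase e g' hg' hed hnone' hall') hb₂.symm hgp' hgq'
    hp₂).2 γ (hd.lt hγ) hγb hγa
  refine hp₂γ u ?_
  rw [← hep p₂ u hpq₂.symm hpx₂ hpx₂', ← hagree' p₂ u hp₂s (hbig u (hp₂ u (hg'.adj hu))), hu]

end Final

section Structure

variable {V : Type*} [Fintype V] [DecidableEq V] {G : SimpleGraph V} [DecidableRel G.Adj]
  {K : ℕ} {x q x₁ x₂ y₁ y₂ p₁ : V}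

lemma Critical.exists_bigs_of_adj (hG : Critical G K) (hx : FewBig G x₁) (hy : SmallNbr G x₁ y₁)
    (hq : G.Adj x₁ q) (hq3 : 3 ≤ G.degree q) :
    ∃ p, Bigs G x₁ q p ∧ (∀ u, G.Adj q u → 3 ≤ G.degree u) ∧ ∀ u, G.Adj p u → 3 ≤ G.degree u := by
  obtain ⟨z₁, z₂, hb, h⟩ := hG.exists_bigs hx hy
  rcases hb.only q hq hq3 with rfl | rfl
  · exact ⟨z₂, hb, (h _ hb.adj₁ hb.deg₁).2, (h _ hb.adj₂ hb.deg₂).2⟩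
  · exact ⟨z₁, hb.symm, (h _ hb.adj₂ hb.deg₂).2, (h _ hb.adj₁ hb.deg₁).2⟩

lemma Critical.exists_cleared (hG : Critical G K) (hx : FewBig G x₁) (hy : SmallNbr G x₁ y₁)
    (hb : Bigs G x₁ q p₁) (hx₂3 : 3 ≤ G.degree x₂) (hx₁3 : 3 ≤ G.degree x₁) (hx₂ : x₁ ≠ x₂)
    {p₂ : V} (hqx : G.Adj q x₂) (hp₂ : G.Adj x₂ p₂) (hp₂3 : 3 ≤ G.degree p₂) (hpx : p₂ ≠ x₁) :
    ∃ d a b γ ρ, Valid G K d ∧ d x₁ q = some a ∧ d x₁ p₁ = some b ∧ a ≠ ρ ∧ Misses d q b ∧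
      Misses d p₁ a ∧ d q x₂ = some γ ∧ d x₂ p₂ = some ρ ∧
      (∀ w, SmallNbr G x₁ w → d x₁ w = none) ∧ (∀ w, SmallNbr G x₂ w → d x₂ w = none) ∧
      ∀ u v, G.Adj u v → d u v = none → (u = x₁ ∧ SmallNbr G x₁ v) ∨
        (v = x₁ ∧ SmallNbr G x₁ u) ∨ (u = x₂ ∧ SmallNbr G x₂ v) ∨ (v = x₂ ∧ SmallNbr G x₂ u) := by
  obtain ⟨y', hs⟩ := hy.exists_isSmall
  obtain ⟨c, hc⟩ := hG.exists_fullExcept hs.adj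
  have hcolor : ∀ u v, G.Adj u v → 3 ≤ G.degree u → 3 ≤ G.degree v → ∃ δ, c u v = some δ := by
    intro u v huv hu hv
    cases h : c u v with
    | some δ => exact ⟨δ, rfl⟩
    | none =>
      have := hy.2
      rcases hc.full u v huv h with ⟨rfl, rfl⟩ | ⟨rfl, rfl⟩ <;> omega
  obtain ⟨a, h1⟩ := hcolor x₁ q hb.adj₁ hx₁3 hb.deg₁
  obtain ⟨b, h2⟩ := hcolor x₁ p₁ hb.adj₂ hx₁3 hb.deg₂
  obtain ⟨γ, hγ⟩ := hcolor q x₂ hqx hb.deg₁ hx₂3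
  obtain ⟨ρ, hρ⟩ := hcolor x₂ p₂ hp₂ hx₂3 hp₂3
  have hm1 := (hc.misses hG hx hs hb h1 h2).1
  have hm2 := (hc.misses hG hx hs hb.symm h2 h1).1
  have hsymm := hc.valid.symm
  have hq3 := hb.deg₁
  have hp3 := hb.deg₂
  have hqx₁ := hb.adj₁.ne'
  have hpx₁ := hb.adj₂.ne'
  have hv := hc.valid.clear x₂
  set e := clear G x₂ c with he
  have hec : ∀ u v δ, e u v = some δ → c u v = some δ := by grind [clear]
  have hce : ∀ u v, 3 ≤ G.degree u → 3 ≤ G.degree v → e u v = c u v := by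
    intro u v hu hv
    rw [he, clear, if_neg (by omega)]
  have hen : ∀ w, SmallNbr G x₂ w → e x₂ w = none := fun w hw => by
    rw [he, clear, if_pos (.inl ⟨rfl, hw.2⟩)]
  have hefull : ∀ u v, G.Adj u v → e u v = none → (u = x₁ ∧ SmallNbr G x₁ v) ∨
      (v = x₁ ∧ SmallNbr G x₁ u) ∨ (u = x₂ ∧ SmallNbr G x₂ v) ∨ (v = x₂ ∧ SmallNbr G x₂ u) := by
    intro u v huv h
    rw [he, clear] at h
    split_ifs at h with hif
    · rcases hif with ⟨rfl, h2⟩ | ⟨rfl, h2⟩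
      · exact .inr (.inr (.inl ⟨rfl, huv, h2⟩))
      · exact .inr (.inr (.inr ⟨rfl, huv.symm, h2⟩))
    · rcases hc.full u v huv h with ⟨rfl, rfl⟩ | ⟨rfl, rfl⟩
      · exact .inl ⟨rfl, hy⟩
      · exact .inr (.inl ⟨rfl, hy⟩)
  obtain ⟨d, a', b', hd, h1', h2', haρ, hmq, hmp, hagree, hnone⟩ :
      ∃ d a' b', Valid G K d ∧ d x₁ q = some a' ∧ d x₁ p₁ = some b' ∧ a' ≠ ρ ∧ Misses d q b' ∧
        Misses d p₁ a' ∧ (∀ u v, u ≠ x₁ → v ≠ x₁ → d u v = e u v) ∧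
        ∀ t, SmallNbr G x₁ t → d x₁ t = none := by
    have h1e : e x₁ q = some a := by rw [hce _ _ hx₁3 hq3, h1]
    have h2e : e x₁ p₁ = some b := by rw [hce _ _ hx₁3 hp3, h2]
    have hm1e : Misses e q b := fun u hu => hm1 u (hec _ _ _ hu)
    have hm2e : Misses e p₁ a := fun u hu => hm2 u (hec _ _ _ hu)
    have hab : a ≠ b := by
      rintro rfl
      exact hb.ne (hc.valid.proper h1 h2)
    by_cases haρ : a = ρ
    · obtain ⟨d, hd, h1', h2', hagree, hnone⟩ := hb.exists_swap hG hv h1e h2e hm1e hm2e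
      refine ⟨d, b, a, hd, h1', h2', fun h => hab (haρ.trans h.symm), fun u hu => ?_,
        fun u hu => ?_, hagree, hnone⟩
      · by_cases hux : u = x₁
        · rw [hux, hd.symm, h1'] at hu
          exact hab (Option.some.inj hu).symm
        · rw [hagree _ _ hqx₁ hux] at hu
          exact hux (hv.proper hu (by rw [hv.symm, h1e]))
      · by_cases hux : u = x₁
        · rw [hux, hd.symm, h2'] at hu
          exact hab (Option.some.inj hu)
        · rw [hagree _ _ hpx₁ hux] at hu
          exact hux (hv.proper hu (by rw [hv.symm, h2e]))
    · refine ⟨clear G x₁ e, a, b, hv.clear x₁, ?_, ?_, haρ, fun u hu => hm1e u ?_,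
        fun u hu => hm2e u ?_, fun u v hu hv => ?_, fun t ht => ?_⟩
      · rw [clear, if_neg (by omega), h1e]
      · rw [clear, if_neg (by omega), h2e]
      · grind [clear]
      · grind [clear]
      · rw [clear, if_neg (by tauto)]
      · rw [clear, if_pos (.inl ⟨rfl, ht.2⟩)]
  refine ⟨d, a', b', γ, ρ, hd, h1', h2', haρ, hmq, hmp, ?_, ?_, hnone, fun w hw => ?_,
    fun u v huv h => ?_⟩
  · rw [hagree _ _ hqx₁ hx₂.symm, hce _ _ hq3 hx₂3, hγ]
  · rw [hagree _ _ hx₂.symm hpx, hce _ _ hx₂3 hp₂3, hρ]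
  · have hwx : w ≠ x₁ := by
      rintro rfl
      have := hw.2
      omega
    rw [hagree _ _ hx₂.symm hwx, hen w hw]
  · by_cases hu : u = x₁
    · subst hu
      refine .inl ⟨rfl, (hG.smallNbr_or huv).resolve_right fun hv3 => ?_⟩
      rcases hb.only v huv hv3 with rfl | rfl
      · rw [h1'] at h
        cases h
      · rw [h2'] at h
        cases h
    by_cases hvx : v = x₁
    · subst hvx
      rw [hd.symm] at h
      refine .inr (.inl ⟨rfl, (hG.smallNbr_or huv.symm).resolve_right fun hu3 => ?_⟩)
      rcases hb.only u huv.symm hu3 with rfl | rfl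
      · rw [h1'] at h
        cases h
      · rw [h2'] at h
        cases h
    rw [hagree u v hu hvx] at h
    exact hefull u v huv h

lemma Critical.eq_of_adj_big (hG : Critical G K) (hx₁ : FewBig G x₁) (hx₂ : FewBig G x₂)
    (hy₁ : SmallNbr G x₁ y₁) (hy₂ : SmallNbr G x₂ y₂) (hq₁ : G.Adj x₁ q) (hq₂ : G.Adj x₂ q)
    (hq3 : 3 ≤ G.degree q) : x₁ = x₂ := by
  by_contra hx
  obtain ⟨p₁, hb₁, hq, hp₁⟩ := hG.exists_bigs_of_adj hx₁ hy₁ hq₁ hq3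
  obtain ⟨p₂, hb₂, -, hp₂⟩ := hG.exists_bigs_of_adj hx₂ hy₂ hq₂ hq3
  have hne : ∀ {x y p : V}, SmallNbr G x y → (∀ u, G.Adj p u → 3 ≤ G.degree u) → p ≠ x := by
    rintro x y p hy hp rfl
    have := hp _ hy.1
    have := hy.2
    omega
  have hpx₁ := hne hy₂ hp₁
  have hpx₂ := hne hy₁ hp₂
  have hx₁3 := hq _ hq₁.symm
  have hx₂3 := hq _ hq₂.symm
  have hadj : ¬ G.Adj x₁ x₂ := fun h => by
    rcases hb₁.only x₂ h hx₂3 with h | h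
    · exact hq₂.ne h
    · exact hpx₁ h.symm
  obtain ⟨d, a, b, γ, ρ, hd, h1, h2, haρ, hmq, hmp, hγ, hρ, hn₁, hn₂, hfull⟩ :=
    hG.exists_cleared hx₁ hy₁ hb₁ hx₂3 hx₁3 hx hq₂.symm hb₂.adj₂ hb₂.deg₂ hpx₂
  refine hG.false_of_coloring hx₁ hx₂ hb₁ hb₂ hq hp₁ hp₂ hx hadj hpx₁ hpx₂ (fun w hw hw₂ => ?_) hd
    h1 h2 haρ hmq hmp hγ hρ hn₁ hn₂ hfull
  obtain ⟨w', hs⟩ := hw.exists_isSmall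
  obtain rfl : x₂ = w' := (hs.only x₂ hw₂.symm).resolve_left fun h => hx h.symm
  exact hG.not_adj_second hx₁ hs hq₁ hq3 hq₂

lemma Critical.exists_smallNbr (hG : Critical G K) (hx : FewBig G x) (hx3 : 3 ≤ G.degree x) :
    ∃ y, SmallNbr G x y := by
  by_contra! hcon
  have hfilter : (G.neighborFinset x).filter (fun z => 3 ≤ G.degree z) = G.neighborFinset x :=
    Finset.filter_true_of_mem fun z hz =>
      (hG.smallNbr_or ((mem_neighborFinset ..).1 hz)).resolve_left (hcon z)
  rw [FewBig, hfilter, card_neighborFinset_eq_degree] at hx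
  omega

/-- A critical graph having a vertex with a neighbor of degree two and at most two neighbors of
larger degree is not 2-degenerate. -/
lemma Critical.not_twoDegenerate (hG : Critical G K) (hx : FewBig G x) {y : V}
    (hy : SmallNbr G x y) : ¬ TwoDegenerate G := by
  intro hdeg
  have hK := hG.four_lt hx hy
  obtain ⟨z, _, hb, hz⟩ := hG.exists_bigs hx hy
  have hnot : ∀ u, (∀ t, G.Adj u t → 3 ≤ G.degree t) → 3 ≤ G.degree u → ¬ FewBig G u := by
    intro u hu hu3 hfew
    obtain ⟨t, ht⟩ := hG.exists_smallNbr hfew hu3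
    have := hu t ht.1
    have := ht.2
    omega
  classical
  obtain ⟨q, hqT, hq⟩ := hdeg (Finset.univ.filter fun u => 3 ≤ G.degree u ∧ ¬ FewBig G u)
    ⟨z, by simpa using ⟨hb.deg₁, hnot z (hz z hb.adj₁ hb.deg₁).2 hb.deg₁⟩⟩
  have hT : ∀ s : Finset V, (∀ u ∈ s, G.Adj q u ∧ 3 ≤ G.degree u) → 2 < s.card →
      ∃ u ∈ s, FewBig G u := by
    intro s hs hcard
    by_contra! hcon
    refine (hcard.trans_le (Finset.card_le_card fun u hu => ?_)).not_ge hq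
    simpa using ⟨⟨(hs u hu).2, hcon u hu⟩, (hs u hu).1⟩
  rw [Finset.mem_filter, FewBig, not_le] at hqT
  obtain ⟨-, hq3, hqbig⟩ := hqT
  obtain ⟨x₁, hx₁, hfew₁⟩ := hT _ (fun u hu => by simpa using hu) hqbig
  rw [Finset.mem_filter, mem_neighborFinset] at hx₁
  obtain ⟨y₁, hy₁⟩ := hG.exists_smallNbr hfew₁ hx₁.2
  obtain ⟨-, -, -, hz₁⟩ := hG.exists_bigs hfew₁ hy₁
  obtain ⟨hqK, hqall⟩ := hz₁ q hx₁.1.symm hq3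
  obtain ⟨x₂, hx₂, hfew₂⟩ := hT ((G.neighborFinset q).erase x₁) (fun u hu => by
    have := (mem_neighborFinset ..).1 (Finset.mem_of_mem_erase hu)
    exact ⟨this, hqall u this⟩) (by
    rw [Finset.card_erase_of_mem (by simpa using hx₁.1), card_neighborFinset_eq_degree]
    omega)
  obtain ⟨hne, hadj⟩ := Finset.mem_erase.1 hx₂
  rw [mem_neighborFinset] at hadj
  obtain ⟨y₂, hy₂⟩ := hG.exists_smallNbr hfew₂ (hqall x₂ hadj)
  exact hne (hG.eq_of_adj_big hfew₂ hfew₁ hy₂ hy₁ hadj.symm hx₁.1.symm hq3)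

end Structure

section Translation

variable {G H : SimpleGraph V} {K : ℕ}

lemma IsAcyclicEdgeColoring.valid {c : Sym2 V → Option ℕ} (hc : IsAcyclicEdgeColoring H K c)
    (hH : H ≤ G) : Valid G K fun u v => c s(u, v) := by
  obtain ⟨⟨⟨hedge, hproper⟩, hcycle⟩, hall⟩ := hc
  have hadj : ∀ {u v γ}, c s(u, v) = some γ → H.Adj u v := fun {u v γ} h =>
    hedge s(u, v) (by rw [h]; rfl)
  refine ⟨fun u v => by rw [Sym2.eq_swap], fun h => hH (hadj h), fun {u v γ} h => ?_,
    fun {u v w γ} h1 h2 => ?_, fun α β v W hW => ?_⟩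
  · obtain ⟨a, ha, h'⟩ := hall s(u, v) (hadj h)
    rw [h] at h'
    exact Option.some.inj h' ▸ ha
  · by_contra hvw
    exact hproper (hadj h1) (hadj h2) hvw (by rw [h1]; rfl) (h1.trans h2.symm)
  · have hcol : ∀ e ∈ W.edges, c e = some α ∨ c e = some β := by
      intro e he
      have := W.edges_subset_edgeSet he
      induction e with | h u w
      rw [mem_edgeSet, bichromatic, fromRel_adj, Sym2.eq_swap (a := w)] at this
      exact this.2.elim id id
    have hmem : ∀ e ∈ W.edges, e ∈ H.edgeSet := fun e he =>
      hedge e (by rcases hcol e he with h | h <;> rw [h] <;> rfl)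
    refine hcycle α β v (W.transfer H hmem) (hW.transfer hmem) ?_
    rwa [Walk.edges_transfer]

lemma Valid.isAcyclicEdgeColoring {f : V → V → Option ℕ} (hf : Valid G K f)
    (hfull : ∀ u v, G.Adj u v → f u v ≠ none) :
    IsAcyclicEdgeColoring G K (Sym2.lift ⟨f, hf.symm⟩) := by
  refine ⟨⟨⟨fun e he => ?_, fun u v w hv hw hne hsome h => ?_⟩, fun α β v W hW hcol => ?_⟩,
    fun e he => ?_⟩
  · induction e with | h u v
    obtain ⟨γ, hγ⟩ := Option.isSome_iff_exists.1 he
    exact hf.adj hγ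
  · obtain ⟨γ, hγ⟩ := Option.isSome_iff_exists.1 hsome
    exact hne (hf.proper hγ (h.symm.trans hγ))
  · have hmem : ∀ e ∈ W.edges, e ∈ (bichromatic f α β).edgeSet := by
      intro e he
      have := hcol e he
      induction e with | h u w
      exact hf.bichromatic_adj.2 this
    exact hf.acyclic α β _ (hW.transfer hmem)
  · induction e with | h u v
    obtain ⟨γ, hγ⟩ := Option.ne_none_iff_exists'.1 (hfull u v he)
    exact ⟨γ, hf.lt hγ, hγ⟩

lemma critical_of_minimal [Fintype V] [DecidableRel G.Adj]
    (hmin : ¬ ∃ c : Sym2 V → Option ℕ, IsAcyclicEdgeColoring G (G.maxDegree + 1) c)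
    (hdel : ∀ e ∈ G.edgeSet, ∃ c : Sym2 V → Option ℕ,
      IsAcyclicEdgeColoring (G.deleteEdges {e}) (G.maxDegree + 1) c) :
    Critical G (G.maxDegree + 1) where
  deg v := Nat.succ_le_succ (G.degree_le_maxDegree v)
  stuck f hf := by
    by_contra! hcon
    exact hmin ⟨_, hf.isAcyclicEdgeColoring hcon⟩
  del u v huv := by
    obtain ⟨c, hc⟩ := hdel s(u, v) huv
    refine ⟨_, hc.valid (deleteEdges_le _), fun a b hab h => ?_⟩
    by_contra hne
    obtain ⟨γ, -, hγ⟩ := hc.2 s(a, b) (by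
      rw [mem_edgeSet, deleteEdges_adj, Set.mem_singleton_iff, Sym2.eq_iff]
      exact ⟨hab, hne⟩)
    rw [hγ] at h
    cases h

end Translation

/-- Lemma 11(b): in the minimum-counterexample setup, for every degree-2
neighbor `w` of `x` with other neighbor `w'`, the vertex `w'` is not adjacent to any
neighbor of `x`. -/
theorem second_neighbor_nonadjacent_to_neighbors
    {V : Type*} [Fintype V] [DecidableEq V] (G : SimpleGraph V) [DecidableRel G.Adj]
    (h2deg : TwoDegenerate G)
    (hmin : ¬ ∃ c : Sym2 V → Option ℕ, IsAcyclicEdgeColoring G (G.maxDegree + 1) c)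
    (hdel : ∀ e ∈ G.edgeSet, ∃ c : Sym2 V → Option ℕ,
      IsAcyclicEdgeColoring (G.deleteEdges {e}) (G.maxDegree + 1) c)
    (x : V)
    (hxdeg2 : ∃ z, G.Adj x z ∧ G.degree z = 2)
    (hxdeg3 : ((G.neighborFinset x).filter fun z => 3 ≤ G.degree z).card ≤ 2) :
    ∀ w, G.Adj x w → G.degree w = 2 →
      ∀ w', G.Adj w w' → w' ≠ x →
        ∀ v, G.Adj x v → ¬ G.Adj v w' := by
  obtain ⟨z, hz⟩ := hxdeg2
  exact absurd h2deg ((critical_of_minimal hmin hdel).not_twoDegenerate hxdeg3 hz)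

end AEC
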